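/- arXiv:1504.00687 — 11 statements merged into one kernel-verified Lean document; each statement's English description precedes it below -/
import Mathlib

section
/- Let n ≥ 3 be an integer and let s be a real number with 1 < s ≤ (n−1)/(n−2). Then there exists a pair of twice continuously differentiable functions x, y : [0,∞) → ℝ satisfying the system (S_s) for all t ≥ 0 with zero initial data; that is, the solution with zero initial data exists globally to the future. -/
open Real Set Filter

/-- The ODE system (S_s):
`x'' = n − (1/s)(n−1)e^{−2x} − (n/2)((x')² + x'·y')` and
`y'' = n − (2 − 1/s)(n−1)e^{−2y} − (n/2)((y')² + x'·y')`, required at all points of `I`. -/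
def SysS (n : ℕ) (s : ℝ) (x y : ℝ → ℝ) (I : Set ℝ) : Prop :=
  ∀ t ∈ I,
    deriv (deriv x) t =
      (n : ℝ) - (1 / s) * ((n : ℝ) - 1) * Real.exp (-2 * x t)
        - ((n : ℝ) / 2) * ((deriv x t) ^ 2 + deriv x t * deriv y t) ∧
    deriv (deriv y) t =
      (n : ℝ) - (2 - 1 / s) * ((n : ℝ) - 1) * Real.exp (-2 * y t)
        - ((n : ℝ) / 2) * ((deriv y t) ^ 2 + deriv x t * deriv y t)

/-- Zero initial data: `x(0) = y(0) = x'(0) = y'(0) = 0`. -/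
def ZeroInit (x y : ℝ → ℝ) : Prop :=
  x 0 = 0 ∧ y 0 = 0 ∧ deriv x 0 = 0 ∧ deriv y 0 = 0


open scoped NNReal Topology

/-- Global solutions for a bounded Lipschitz autonomous vector field. -/
lemma global_sol {E : Type*} [NormedAddCommGroup E] [NormedSpace ℝ E] [CompleteSpace E]
    (F : E → E) (K L : ℝ≥0) (hK : LipschitzWith K F) (hL : ∀ z, ‖F z‖ ≤ L) (z0 : E) :
    ∃ f : ℝ → E, f 0 = z0 ∧ ∀ t, HasDerivAt f (F (f t)) t := by
  have loc : ∀ N : ℕ, ∃ f : ℝ → E, f 0 = z0 ∧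
      ∀ t ∈ Ioo (-(N + 1 : ℝ)) (N + 1 : ℝ), HasDerivAt f (F (f t)) t := by
    intro N
    have hN : (0 : ℝ) ≤ N := Nat.cast_nonneg N
    have h0 : (0 : ℝ) ∈ Icc (-(N + 1 : ℝ)) (N + 1 : ℝ) := ⟨by linarith, by linarith⟩
    have hP : IsPicardLindelof (fun _ => F) (⟨0, h0⟩ : Icc (-(N + 1 : ℝ)) (N + 1 : ℝ)) z0
        (L * (N + 1)) 0 L K :=
      { lipschitzOnWith := fun t _ => hK.lipschitzOnWith
        continuousOn := fun z _ => continuousOn_const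
        norm_le := fun t _ z _ => hL z
        mul_max_le := by simp }
    obtain ⟨f, hf0, hf⟩ := hP.exists_eq_forall_mem_Icc_hasDerivWithinAt₀
    exact ⟨f, hf0, fun t ht => (hf t (Ioo_subset_Icc_self ht)).hasDerivAt (Icc_mem_nhds ht.1 ht.2)⟩
  choose f hf0 hf using loc
  have key : ∀ M N : ℕ, M ≤ N → EqOn (f M) (f N) (Ioo (-(M + 1 : ℝ)) (M + 1 : ℝ)) := by
    intro M N h
    have hM : (0 : ℝ) ≤ M := Nat.cast_nonneg M
    have hMN : (M : ℝ) ≤ N := Nat.cast_le.2 h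
    refine ODE_solution_unique_of_mem_Ioo (v := fun _ => F) (s := fun _ => univ) (K := K) (t₀ := 0)
      (fun t _ => hK.lipschitzOnWith) ⟨by linarith, by linarith⟩
      (fun t ht => ⟨hf M t ht, mem_univ _⟩)
      (fun t ht => ⟨hf N t ⟨by linarith [ht.1], by linarith [ht.2]⟩, mem_univ _⟩) ?_
    rw [hf0, hf0]
  have key2 : ∀ M N : ℕ, ∀ t : ℝ, |t| < M + 1 → |t| < N + 1 → f M t = f N t := by
    intro M N t h1 h2
    rcases le_total M N with h | h
    · exact key M N h (abs_lt.1 h1)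
    · exact (key N M h (abs_lt.1 h2)).symm
  have hfl : ∀ t : ℝ, |t| < (⌊|t|⌋₊ : ℝ) + 1 := fun t => Nat.lt_floor_add_one _
  refine ⟨fun t => f ⌊|t|⌋₊ t, by simp [hf0], fun t => ?_⟩
  have h := hf ⌊|t|⌋₊ t (abs_lt.1 (hfl t))
  refine h.congr_of_eventuallyEq ?_
  filter_upwards [(isOpen_lt continuous_abs continuous_const).mem_nhds (hfl t)] with r hr
  exact key2 _ _ r (hfl r) hr

/-- Barrier lemma. -/
lemma barrier_le (u u' : ℝ → ℝ) (c : ℝ) (hu : ∀ t, HasDerivAt u (u' t) t) (h0 : u 0 ≤ c)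
    (h : ∀ t, 0 ≤ t → c ≤ u t → u' t ≤ 0) : ∀ t, 0 ≤ t → u t ≤ c := by
  intro t1 ht1
  by_contra! hc
  have hcont : Continuous u := continuous_iff_continuousAt.2 fun t => (hu t).continuousAt
  have hS : IsCompact (Icc 0 t1 ∩ {t | u t ≤ c}) :=
    isCompact_Icc.inter_right (isClosed_le hcont continuous_const)
  obtain ⟨t0, ⟨⟨h1, h2⟩, h3⟩, h4⟩ := hS.exists_isGreatest ⟨0, ⟨le_rfl, ht1⟩, h0⟩
  have h3' : u t0 ≤ c := h3
  have hgt : ∀ t ∈ Ioc t0 t1, c < u t := by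
    intro t ht
    by_contra! hle
    have := h4 ⟨⟨h1.trans ht.1.le, ht.2⟩, hle⟩
    linarith [ht.1]
  have hanti : AntitoneOn u (Icc t0 t1) := by
    refine antitoneOn_of_deriv_nonpos (convex_Icc _ _) hcont.continuousOn
      (fun t _ => (hu t).differentiableAt.differentiableWithinAt) ?_
    intro t ht
    rw [interior_Icc] at ht
    rw [(hu t).deriv]
    exact h t (h1.trans ht.1.le) (hgt t ⟨ht.1, ht.2.le⟩).le
  have := hanti ⟨le_rfl, h2⟩ ⟨h2, le_rfl⟩ h2
  linarith

lemma barrier_ge (u u' : ℝ → ℝ) (c : ℝ) (hu : ∀ t, HasDerivAt u (u' t) t) (h0 : c ≤ u 0)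
    (h : ∀ t, 0 ≤ t → u t ≤ c → 0 ≤ u' t) : ∀ t, 0 ≤ t → c ≤ u t := by
  intro t ht
  have := barrier_le (fun t => - u t) (fun t => - u' t) (-c) (fun t => (hu t).neg) (by simpa)
    (fun t ht hc => by have := h t ht (by simpa using hc); simpa using this) t ht
  simpa using this

/-- Truncation to `[0,b]`. -/
noncomputable def clampR (b x : ℝ) : ℝ := max 0 (min b x)

lemma clampR_nonneg (b x : ℝ) : 0 ≤ clampR b x := le_max_left _ _
lemma clampR_le {b : ℝ} (hb : 0 ≤ b) (x : ℝ) : clampR b x ≤ b := max_le hb (min_le_left _ _)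
lemma clampR_of_le {b x : ℝ} (h : x ≤ 0) : clampR b x = 0 :=
  max_eq_left ((min_le_right _ _).trans h)
lemma clampR_of_ge {b x : ℝ} (hb : 0 ≤ b) (h : b ≤ x) : clampR b x = b := by
  simp [clampR, h, hb]
lemma clampR_eq {b x : ℝ} (h0 : 0 ≤ x) (h : x ≤ b) : clampR b x = x := by
  simp [clampR, h, h0]
lemma clampR_lip {α : Type*} [PseudoEMetricSpace α] {f : α → ℝ} {K : ℝ≥0} (hf : LipschitzWith K f)
    (b : ℝ) : LipschitzWith K (fun z => clampR b (f z)) := (hf.const_min b).const_max 0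
lemma clampR_continuous (b : ℝ) : Continuous (clampR b) := by
  unfold clampR; fun_prop

/-- Polynomial vector field in the variables `(e^{-2x}, e^{-2y}, x', y')`. -/
noncomputable def polyG (m A B : ℝ) (z : ℝ × ℝ × ℝ × ℝ) : ℝ × ℝ × ℝ × ℝ :=
  (-2 * z.1 * z.2.2.1, -2 * z.2.1 * z.2.2.2,
    m - A * z.1 - m / 2 * (z.2.2.1 ^ 2 + z.2.2.1 * z.2.2.2),
    m - B * z.2.1 - m / 2 * (z.2.2.2 ^ 2 + z.2.2.1 * z.2.2.2))

/-- Truncation to the box. -/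
noncomputable def clampE (z : ℝ × ℝ × ℝ × ℝ) : ℝ × ℝ × ℝ × ℝ :=
  (clampR 1 z.1, clampR 1 z.2.1, clampR 2 z.2.2.1, clampR 2 z.2.2.2)

lemma first_order (m A B : ℝ) (hm : 0 ≤ m) (hA0 : 0 ≤ A) (hB0 : 0 ≤ B) (hA : A ≤ m) (hB : B ≤ m) :
    ∃ u v p q : ℝ → ℝ, u 0 = 1 ∧ v 0 = 1 ∧ p 0 = 0 ∧ q 0 = 0 ∧ ContDiff ℝ 1 p ∧ ContDiff ℝ 1 q ∧
      ∀ t, 0 ≤ t →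
        HasDerivAt u (-2 * u t * p t) t ∧ HasDerivAt v (-2 * v t * q t) t ∧
        HasDerivAt p (m - A * u t - m / 2 * (p t ^ 2 + p t * q t)) t ∧
        HasDerivAt q (m - B * v t - m / 2 * (q t ^ 2 + p t * q t)) t := by
  have hGd : ContDiff ℝ 1 (polyG m A B) := by unfold polyG; fun_prop
  set S : Set (ℝ × ℝ × ℝ × ℝ) := Icc 0 1 ×ˢ Icc 0 1 ×ˢ Icc 0 2 ×ˢ Icc 0 2 with hS
  have hSc : IsCompact S :=
    isCompact_Icc.prod (isCompact_Icc.prod (isCompact_Icc.prod isCompact_Icc))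
  have hmem : ∀ z, clampE z ∈ S := fun z =>
    ⟨⟨clampR_nonneg _ _, clampR_le zero_le_one _⟩, ⟨clampR_nonneg _ _, clampR_le zero_le_one _⟩,
      ⟨clampR_nonneg _ _, clampR_le zero_le_two _⟩, ⟨clampR_nonneg _ _, clampR_le zero_le_two _⟩⟩
  obtain ⟨K, hK⟩ : ∃ K, LipschitzOnWith K (polyG m A B) S :=
    LocallyLipschitzOn.exists_lipschitzOnWith_of_compact hSc
      (hGd.locallyLipschitz.locallyLipschitzOn)
  obtain ⟨K', hK'⟩ : ∃ K', LipschitzWith K' clampE :=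
    ⟨_, (clampR_lip LipschitzWith.prod_fst 1).prodMk
      ((clampR_lip (LipschitzWith.prod_fst.comp LipschitzWith.prod_snd) 1).prodMk
      ((clampR_lip (LipschitzWith.prod_fst.comp
        (LipschitzWith.prod_snd.comp LipschitzWith.prod_snd)) 2).prodMk
       (clampR_lip (LipschitzWith.prod_snd.comp
        (LipschitzWith.prod_snd.comp LipschitzWith.prod_snd)) 2)))⟩
  obtain ⟨L, hL⟩ := hSc.exists_bound_of_continuousOn hGd.continuous.continuousOn
  have hFl : LipschitzWith (K * K') (fun z => polyG m A B (clampE z)) := by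
    rw [← lipschitzOnWith_univ]
    exact hK.comp hK'.lipschitzOnWith (fun z _ => hmem z)
  obtain ⟨f, hf0, hf⟩ := global_sol (fun z => polyG m A B (clampE z)) _ L.toNNReal hFl
    (fun z => (hL _ (hmem z)).trans (Real.le_coe_toNNReal L)) (1, 1, 0, 0)
  have hfc : Continuous f := continuous_iff_continuousAt.2 fun t => (hf t).continuousAt
  have hFc : Continuous (fun t => polyG m A B (clampE (f t))) := hFl.continuous.comp hfc
  have hu : ∀ t, HasDerivAt (fun t => (f t).1) (polyG m A B (clampE (f t))).1 t :=
    fun t => (hf t).fst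
  have hv : ∀ t, HasDerivAt (fun t => (f t).2.1) (polyG m A B (clampE (f t))).2.1 t :=
    fun t => (hf t).snd.fst
  have hp : ∀ t, HasDerivAt (fun t => (f t).2.2.1) (polyG m A B (clampE (f t))).2.2.1 t :=
    fun t => (hf t).snd.snd.fst
  have hq : ∀ t, HasDerivAt (fun t => (f t).2.2.2) (polyG m A B (clampE (f t))).2.2.2 t :=
    fun t => (hf t).snd.snd.snd
  have bu0 := barrier_ge _ _ 0 hu (by simp [hf0]) (fun t _ h => by
    simp [polyG, clampE, clampR_of_le h])
  have bv0 := barrier_ge _ _ 0 hv (by simp [hf0]) (fun t _ h => by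
    simp [polyG, clampE, clampR_of_le h])
  have bu1 := barrier_le _ _ 1 hu (by simp [hf0]) (fun t _ h => by
    have := clampR_nonneg 2 (f t).2.2.1
    simp [polyG, clampE, clampR_of_ge zero_le_one h, this])
  have bv1 := barrier_le _ _ 1 hv (by simp [hf0]) (fun t _ h => by
    have := clampR_nonneg 2 (f t).2.2.2
    simp [polyG, clampE, clampR_of_ge zero_le_one h, this])
  have bp0 := barrier_ge _ _ 0 hp (by simp [hf0]) (fun t _ h => by
    have := mul_le_of_le_one_right hA0 (clampR_le zero_le_one (f t).1)
    simp [polyG, clampE, clampR_of_le h]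
    linarith)
  have bq0 := barrier_ge _ _ 0 hq (by simp [hf0]) (fun t _ h => by
    have := mul_le_of_le_one_right hB0 (clampR_le zero_le_one (f t).2.1)
    simp [polyG, clampE, clampR_of_le h]
    linarith)
  have bp2 := barrier_le _ _ 2 hp (by simp [hf0]) (fun t _ h => by
    have h1 := mul_nonneg hA0 (clampR_nonneg 1 (f t).1)
    have h2 := mul_nonneg hm (clampR_nonneg 2 (f t).2.2.2)
    simp only [polyG, clampE, clampR_of_ge zero_le_two h]
    linarith)
  have bq2 := barrier_le _ _ 2 hq (by simp [hf0]) (fun t _ h => by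
    have h1 := mul_nonneg hB0 (clampR_nonneg 1 (f t).2.1)
    have h2 := mul_nonneg hm (clampR_nonneg 2 (f t).2.2.1)
    simp only [polyG, clampE, clampR_of_ge zero_le_two h]
    linarith)
  have cd : ∀ g g' : ℝ → ℝ, (∀ t, HasDerivAt g (g' t) t) → Continuous g' → ContDiff ℝ 1 g := by
    intro g g' hg hg'
    rw [contDiff_one_iff_deriv]
    refine ⟨fun t => (hg t).differentiableAt, ?_⟩
    rwa [show deriv g = g' from funext fun t => (hg t).deriv]
  refine ⟨fun t => (f t).1, fun t => (f t).2.1, fun t => (f t).2.2.1, fun t => (f t).2.2.2,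
    by simp [hf0], by simp [hf0], by simp [hf0], by simp [hf0],
    cd _ _ hp hFc.snd.snd.fst, cd _ _ hq hFc.snd.snd.snd, fun t ht => ?_⟩
  have hcl : clampE (f t) = f t := by
    simp only [clampE, clampR_eq (bu0 t ht) (bu1 t ht), clampR_eq (bv0 t ht) (bv1 t ht),
      clampR_eq (bp0 t ht) (bp2 t ht), clampR_eq (bq0 t ht) (bq2 t ht)]
  have h1 := hu t
  have h2 := hv t
  have h3 := hp t
  have h4 := hq t
  rw [hcl] at h1 h2 h3 h4
  exact ⟨h1, h2, h3, h4⟩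

lemma recover (u p : ℝ → ℝ) (hu0 : u 0 = 1) (hp : ContDiff ℝ 1 p)
    (hu : ∀ t, 0 ≤ t → HasDerivAt u (-2 * u t * p t) t) :
    ∃ x : ℝ → ℝ, x 0 = 0 ∧ ContDiff ℝ 2 x ∧ deriv x = p ∧
      ∀ t, 0 ≤ t → u t = Real.exp (-2 * x t) := by
  have hx : ∀ t, HasDerivAt (fun t => ∫ r in (0 : ℝ)..t, p r) (p t) t := fun t =>
    intervalIntegral.integral_hasDerivAt_right (hp.continuous.intervalIntegrable _ _)
      (hp.continuous.stronglyMeasurableAtFilter _ _) hp.continuous.continuousAt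
  have hd : deriv (fun t => ∫ r in (0 : ℝ)..t, p r) = p := funext fun t => (hx t).deriv
  refine ⟨fun t => ∫ r in (0 : ℝ)..t, p r, by simp, ?_, hd, ?_⟩
  · rw [show (2 : WithTop ℕ∞) = 1 + 1 by norm_num, contDiff_succ_iff_deriv]
    refine ⟨fun t => (hx t).differentiableAt, by simp, by rwa [hd]⟩
  · intro t ht
    set x := fun t => ∫ r in (0 : ℝ)..t, p r with hxd
    have hw : ∀ r, 0 ≤ r → HasDerivAt (fun t => u t * Real.exp (2 * x t)) 0 r := by
      intro r hr
      have := (hu r hr).mul (((hx r).const_mul 2).exp)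
      refine this.congr_deriv ?_
      ring
    have := constant_of_has_deriv_right_zero (f := fun t => u t * Real.exp (2 * x t))
      (a := 0) (b := t)
      (fun r hr => (hw r hr.1).continuousAt.continuousWithinAt)
      (fun r hr => (hw r hr.1).hasDerivWithinAt) t ⟨ht, le_rfl⟩
    simp only [hu0, one_mul] at this
    have hx0 : x 0 = 0 := by simp [hxd]
    rw [hx0] at this
    have h2 : Real.exp (-2 * x t) * Real.exp (2 * x t) = 1 := by
      rw [← Real.exp_add]; simp
    have h3 := (Real.exp_pos (2 * x t)).ne'
    apply mul_right_cancel₀ h3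
    simp only [mul_zero, Real.exp_zero] at this
    change u t * Real.exp (2 * x t) = 1 at this
    change u t * Real.exp (2 * x t) = Real.exp (-2 * x t) * Real.exp (2 * x t)
    rw [this, h2]

/-- For `n ≥ 3` and `1 < s ≤ (n−1)/(n−2)` the solution of `(S_s)` with zero initial
data exists globally on `[0,∞)`. -/
theorem global_existence_equilibrium
    (n : ℕ) (hn : 3 ≤ n) (s : ℝ) (hs1 : 1 < s) (hs2 : s ≤ ((n : ℝ) - 1) / ((n : ℝ) - 2)) :
    ∃ x y : ℝ → ℝ,
      ContDiffOn ℝ 2 x (Ici (0 : ℝ)) ∧ ContDiffOn ℝ 2 y (Ici (0 : ℝ)) ∧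
      SysS n s x y (Ici (0 : ℝ)) ∧ ZeroInit x y := by
  have hn' : (3 : ℝ) ≤ n := by exact_mod_cast hn
  have hs0 : 0 < s := by linarith
  have ha1 : 1 / s < 1 := by rw [div_lt_one hs0]; exact hs1
  have ha0 : 0 < 1 / s := by positivity
  have ha : ((n : ℝ) - 2) ≤ (1 / s) * ((n : ℝ) - 1) := by
    rw [le_div_iff₀ (by linarith)] at hs2
    rw [one_div, ← div_eq_inv_mul, le_div_iff₀ hs0]
    linarith
  obtain ⟨u, v, p, q, hu0, hv0, hp0, hq0, hpc, hqc, h⟩ :=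
    first_order (n : ℝ) ((1 / s) * ((n : ℝ) - 1)) ((2 - 1 / s) * ((n : ℝ) - 1))
      (by linarith) (mul_nonneg ha0.le (by linarith)) (mul_nonneg (by linarith) (by linarith))
      (by nlinarith) (by nlinarith)
  obtain ⟨x, hx0, hxc, hxd, hxu⟩ := recover u p hu0 hpc (fun t ht => (h t ht).1)
  obtain ⟨y, hy0, hyc, hyd, hyv⟩ := recover v q hv0 hqc (fun t ht => (h t ht).2.1)
  refine ⟨x, y, hxc.contDiffOn, hyc.contDiffOn, fun t ht => ?_, hx0, hy0, by rw [hxd, hp0],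
    by rw [hyd, hq0]⟩
  obtain ⟨_, _, h3, h4⟩ := h t ht
  rw [hxd, hyd, h3.deriv, h4.deriv, hxu t ht, hyv t ht]
  exact ⟨rfl, rfl⟩
end

section
/- Let n ≥ 3 be an integer and let s be a real number with 1 < s < (n−1)/(n−2). Let x, y : [0,∞) → ℝ be a twice continuously differentiable solution of the system (S_s) with zero initial data defined for all t ≥ 0. Then there exist constants C > 0 and α > 0 such that |x'(t) − y'(t)| ≤ C·e^{−α t} for all t ≥ 0. -/
open Real Set Filter

/-- Nonnegativity of a component and of its derivative. -/
lemma aux_nonneg (N A : ℝ) (hA0 : 0 ≤ A) (hAN : A < N) (x u p : ℝ → ℝ)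
    (hxc : ContinuousOn x (Ici 0)) (hx : ∀ t, 0 < t → HasDerivAt x (u t) t)
    (hu : ∀ t, 0 ≤ t → HasDerivAt u (N - A * Real.exp (-2 * x t) - N / 2 * (u t * p t)) t)
    (hx0 : x 0 = 0) (hu0 : u 0 = 0) : ∀ t, 0 ≤ t → 0 ≤ u t ∧ 0 ≤ x t := by
  intro T hT
  have huc : ContinuousOn u (Ici 0) := fun t ht => (hu t ht).continuousAt.continuousWithinAt
  have hsub : Icc 0 T ⊆ {t | 0 ≤ u t ∧ 0 ≤ x t} := by
    apply IsClosed.Icc_subset_of_forall_mem_nhdsWithin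
    · have h1 : IsClosed (Icc 0 T ∩ u ⁻¹' Ici 0) :=
        (huc.mono Icc_subset_Ici_self).preimage_isClosed_of_isClosed isClosed_Icc isClosed_Ici
      have h2 : IsClosed (Icc 0 T ∩ x ⁻¹' Ici 0) :=
        (hxc.mono Icc_subset_Ici_self).preimage_isClosed_of_isClosed isClosed_Icc isClosed_Ici
      convert h1.inter h2 using 1
      ext t
      simp only [mem_inter_iff, mem_ofPred_eq, mem_preimage, mem_Ici]
      tauto
    · simp [hx0, hu0]
    · rintro t ⟨⟨hut, hxt⟩, ht0, htT⟩
      have hpos : ∀ᶠ r in nhdsWithin t (Ioi t), 0 < u r := by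
        rcases hut.eq_or_lt with h | h
        · have hd := hu t ht0
          have hdp : 0 < N - A * Real.exp (-2 * x t) - N / 2 * (u t * p t) := by
            rw [← h]
            have : Real.exp (-2 * x t) ≤ 1 := Real.exp_le_one_iff.mpr (by linarith)
            nlinarith
          have hs := hd.hasDerivWithinAt (s := Ioi t)
          rw [hasDerivWithinAt_iff_tendsto_slope' (by simp)] at hs
          filter_upwards [hs.eventually (lt_mem_nhds hdp), self_mem_nhdsWithin] with r hr hrt
          rw [slope_def_field, ← h, sub_zero] at hr
          have hrt' : 0 < r - t := sub_pos.mpr hrt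
          exact (div_pos_iff_of_pos_right hrt').mp hr
        · exact ((hu t ht0).continuousAt.eventually (lt_mem_nhds h)).filter_mono nhdsWithin_le_nhds
      obtain ⟨b, hb, hbu⟩ := (mem_nhdsGT_iff_exists_Ioo_subset).mp hpos
      have hb' : t < b := hb
      filter_upwards [Ioo_mem_nhdsGT hb'] with r hr
      have hm : MonotoneOn x (Icc t r) := by
        apply monotoneOn_of_deriv_nonneg (convex_Icc t r)
        · exact hxc.mono fun z hz => le_trans ht0 hz.1
        · rw [interior_Icc]
          intro z hz
          exact (hx z (lt_of_le_of_lt ht0 hz.1)).differentiableAt.differentiableWithinAt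
        · rw [interior_Icc]
          intro z hz
          rw [(hx z (lt_of_le_of_lt ht0 hz.1)).deriv]
          exact le_of_lt (hbu ⟨hz.1, hz.2.trans hr.2⟩)
      refine ⟨le_of_lt (hbu hr), hxt.trans ?_⟩
      exact hm (left_mem_Icc.mpr hr.1.le) (right_mem_Icc.mpr hr.1.le) hr.1.le
  exact hsub (right_mem_Icc.mpr hT)

/-- Linear lower bounds. -/
lemma aux_lower (N c : ℝ) (hN : 0 < N) (hc : 0 < c) (x u u' : ℝ → ℝ)
    (hxc : ContinuousOn x (Ici 0)) (hx : ∀ t, 0 < t → HasDerivAt x (u t) t)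
    (hu : ∀ t, 0 ≤ t → HasDerivAt u (u' t) t)
    (hu' : ∀ t, 0 ≤ t → c - N * u t ≤ u' t)
    (hx0 : x 0 = 0) (hu0 : u 0 = 0) : ∀ t, 0 ≤ t →
      c / N * (1 - Real.exp (-N * t)) ≤ u t ∧ c / N * t - c / N / N ≤ x t := by
  have huc : ContinuousOn u (Ici 0) := fun t ht => (hu t ht).continuousAt.continuousWithinAt
  have h1 : ∀ t, 0 ≤ t → c / N * (1 - Real.exp (-N * t)) ≤ u t := by
    have hd : ∀ t, 0 ≤ t → HasDerivAt (fun t => Real.exp (N * t) * (u t - c / N))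
        (Real.exp (N * t) * (N * 1) * (u t - c / N) + Real.exp (N * t) * (u' t)) t := fun t ht =>
      (((hasDerivAt_id t).const_mul N).exp).mul ((hu t ht).sub_const _)
    have hm : MonotoneOn (fun t => Real.exp (N * t) * (u t - c / N)) (Ici 0) := by
      apply monotoneOn_of_deriv_nonneg (convex_Ici 0)
      · exact fun t ht => (hd t ht).continuousAt.continuousWithinAt
      · exact fun t ht => (hd t (interior_subset ht)).differentiableAt.differentiableWithinAt
      · intro t ht
        have ht' : 0 ≤ t := interior_subset ht
        rw [(hd t ht').deriv]
        have := hu' t ht'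
        have e : Real.exp (N * t) * (N * 1) * (u t - c / N) + Real.exp (N * t) * (u' t)
          = Real.exp (N * t) * (u' t - (c - N * u t)) := by field_simp; ring
        rw [e]
        exact mul_nonneg (Real.exp_pos _).le (by linarith)
    intro t ht
    have := hm (mem_Ici.mpr le_rfl) (mem_Ici.mpr ht) ht
    simp only [hu0, mul_zero, Real.exp_zero] at this
    have e1 : Real.exp (-N * t) * Real.exp (N * t) = 1 := by
      rw [← Real.exp_add]; simp
    have h3 := mul_le_mul_of_nonneg_left this (Real.exp_pos (-N * t)).le
    rw [← mul_assoc (Real.exp (-N * t)) (Real.exp (N * t)), e1] at h3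
    linarith
  intro t ht
  refine ⟨h1 t ht, ?_⟩
  have hd2 : ∀ t, HasDerivAt (fun t => c / N * (t + Real.exp (-N * t) / N))
      (c / N * (1 + Real.exp (-N * t) * (-N * 1) / N)) t := fun t =>
    ((hasDerivAt_id t).add ((((hasDerivAt_id t).const_mul (-N)).exp).div_const N)).const_mul _
  have hm : MonotoneOn (fun t => x t - c / N * (t + Real.exp (-N * t) / N)) (Ici 0) := by
    apply monotoneOn_of_deriv_nonneg (convex_Ici 0)
    · exact hxc.sub fun t ht => (hd2 t).continuousAt.continuousWithinAt
    · rw [interior_Ici]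
      exact fun t ht => ((hx t ht).sub (hd2 t)).differentiableAt.differentiableWithinAt
    · rw [interior_Ici]
      intro t ht
      have e := ((hx t ht).sub (hd2 t)).deriv
      have e2 : deriv (fun t => x t - c / N * (t + Real.exp (-N * t) / N)) t = _ := e
      rw [e2]
      have := h1 t (le_of_lt ht)
      have e3 : Real.exp (-N * t) * (-N * 1) / N = - Real.exp (-N * t) := by field_simp
      rw [e3]
      linarith
  have := hm (mem_Ici.mpr le_rfl) (mem_Ici.mpr ht) ht
  simp only [hx0, mul_zero, Real.exp_zero] at this
  have h5 : 0 ≤ c / N * (Real.exp (-N * t) / N) := by positivity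
  have h6 : c / N * (0 + 1 / N) = c / N / N := by field_simp; ring
  rw [h6] at this
  linarith

/-- Regularity: the derivative is differentiable on the closed half-line. -/
lemma aux_reg (x : ℝ → ℝ) (hx : ContDiffOn ℝ 2 x (Ici (0 : ℝ)))
    (h0 : deriv (deriv x) 0 ≠ 0) :
    (∀ t, 0 < t → HasDerivAt x (deriv x t) t) ∧
    (∀ t, 0 ≤ t → HasDerivAt (deriv x) (deriv (deriv x) t) t) := by
  have hat : ∀ t, 0 < t → ContDiffAt ℝ 2 x t := fun t ht => hx.contDiffAt (Ici_mem_nhds ht)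
  refine ⟨fun t ht => ((hat t ht).differentiableAt (by norm_num)).hasDerivAt, fun t ht => ?_⟩
  rcases ht.eq_or_lt with h | h
  · subst h
    exact (differentiableAt_of_deriv_ne_zero h0).hasDerivAt
  · have : ContDiffAt ℝ 1 (deriv x) t := (hat t h).derivWithin (by norm_num)
    exact (this.differentiableAt (by norm_num)).hasDerivAt

/-- Comparison for the decay. -/
lemma aux_decay (N κ K C : ℝ) (hN : 3 ≤ N) (hκ : 0 < κ) (hCpos : 0 < C) (hC : 2 * K < κ * C)
    (w f p : ℝ → ℝ)
    (hw : ∀ t, 0 ≤ t → HasDerivAt w (f t - N / 2 * (p t * w t)) t)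
    (hf : ∀ t, 0 ≤ t → f t ≤ K * Real.exp (-κ * t))
    (hp : ∀ t, 1 ≤ t → κ ≤ p t)
    (h1 : w 1 ≤ C * Real.exp (-κ * 1)) : ∀ t, 1 ≤ t → w t ≤ C * Real.exp (-κ * t) := by
  intro T hT
  have hB : ∀ t, HasDerivAt (fun t => C * Real.exp (-κ * t)) (C * (Real.exp (-κ * t) * (-κ * 1))) t :=
    fun t => (((hasDerivAt_id t).const_mul (-κ)).exp).const_mul C
  refine image_le_of_deriv_right_lt_deriv_boundary (f := w)
    (f' := fun t => f t - N / 2 * (p t * w t)) (a := 1) (b := T)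
    (fun t ht => (hw t (by linarith [ht.1])).continuousAt.continuousWithinAt)
    (fun t ht => (hw t (by linarith [ht.1])).hasDerivWithinAt) h1 hB ?_ (right_mem_Icc.mpr hT)
  intro t ht heq
  have hE := Real.exp_pos (-κ * t)
  have hft := hf t (by linarith [ht.1])
  have hpt := hp t ht.1
  beta_reduce at heq ⊢
  rw [heq]
  have hCE : 0 < C * Real.exp (-κ * t) := mul_pos hCpos hE
  have h2 : κ * (C * Real.exp (-κ * t)) ≤ p t * (C * Real.exp (-κ * t)) :=
    mul_le_mul_of_nonneg_right hpt hCE.le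
  have h3 : 2 * K * Real.exp (-κ * t) < κ * C * Real.exp (-κ * t) :=
    mul_lt_mul_of_pos_right hC hE
  have h4 : 0 < κ * (C * Real.exp (-κ * t)) := mul_pos hκ hCE
  have h5 : 3 / 2 * (κ * (C * Real.exp (-κ * t))) ≤ N / 2 * (p t * (C * Real.exp (-κ * t))) :=
    mul_le_mul (by linarith) h2 h4.le (by linarith)
  nlinarith

/-- For `n ≥ 3` and `1 < s < (n−1)/(n−2)`, along a global solution of `(S_s)` with zero
initial data, `x' − y'` decays exponentially. -/
theorem exponential_decay_of_derivative_difference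
    (n : ℕ) (hn : 3 ≤ n) (s : ℝ) (hs1 : 1 < s) (hs2 : s < ((n : ℝ) - 1) / ((n : ℝ) - 2))
    (x y : ℝ → ℝ)
    (hx : ContDiffOn ℝ 2 x (Ici (0 : ℝ))) (hy : ContDiffOn ℝ 2 y (Ici (0 : ℝ)))
    (hsys : SysS n s x y (Ici (0 : ℝ))) (hinit : ZeroInit x y) :
    ∃ C > (0 : ℝ), ∃ α > (0 : ℝ), ∀ t : ℝ, 0 ≤ t →
      |deriv x t - deriv y t| ≤ C * Real.exp (-α * t) := by
  obtain ⟨hx0, hy0, hu0, hv0⟩ := hinit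
  have hN : (3 : ℝ) ≤ (n : ℝ) := by exact_mod_cast hn
  set N : ℝ := (n : ℝ) with hNdef
  have hs0 : 0 < s := by linarith
  have ha1 : 1 / s < 1 := by rw [div_lt_one hs0]; exact hs1
  have ha0 : 0 < 1 / s := by positivity
  have han : N - 2 < 1 / s * (N - 1) := by
    rw [lt_div_iff₀ (by linarith)] at hs2
    rw [one_div, inv_mul_eq_div, lt_div_iff₀ hs0]
    linarith
  unfold SysS at hsys
  rw [← hNdef] at hsys
  set a : ℝ := 1 / s with hadef
  have hb0 : 0 < 2 - a := by linarith
  set A : ℝ := a * (N - 1) with hA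
  set B : ℝ := (2 - a) * (N - 1) with hB
  have hAB : A + B = 2 * (N - 1) := by rw [hA, hB]; ring
  have hA0 : 0 < A := mul_pos ha0 (by linarith)
  have hB0 : 0 < B := mul_pos hb0 (by linarith)
  have hBN : B < N := by linarith
  have hAleB : A ≤ B := mul_le_mul_of_nonneg_right (by linarith) (by linarith)
  have hAN : A < N := by linarith
  have hs00 := hsys 0 (mem_Ici.mpr le_rfl)
  simp only [hx0, hy0, hu0, hv0, mul_zero, Real.exp_zero] at hs00
  obtain ⟨hx1, hx2⟩ := aux_reg x hx (by rw [hs00.1]; apply ne_of_gt; norm_num; linarith)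
  obtain ⟨hy1, hy2⟩ := aux_reg y hy (by rw [hs00.2]; apply ne_of_gt; norm_num; linarith)
  have hxc := hx.continuousOn
  have hyc := hy.continuousOn
  set u := deriv x
  set v := deriv y
  have hu : ∀ t, 0 ≤ t →
      HasDerivAt u (N - A * Real.exp (-2 * x t) - N / 2 * (u t * (u t + v t))) t := by
    intro t ht
    convert hx2 t ht using 1
    rw [(hsys t ht).1]; ring
  have hv : ∀ t, 0 ≤ t →
      HasDerivAt v (N - B * Real.exp (-2 * y t) - N / 2 * (v t * (u t + v t))) t := by
    intro t ht
    convert hy2 t ht using 1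
    rw [(hsys t ht).2]; ring
  have hupos := aux_nonneg N A hA0.le hAN x u (fun t => u t + v t) hxc hx1 hu hx0 hu0
  have hvpos := aux_nonneg N B hB0.le hBN y v (fun t => u t + v t) hyc hy1 hv hy0 hv0
  -- upper bound on the sum
  have hp2 : ∀ t, 0 ≤ t → u t + v t ≤ 2 := by
    intro T hT
    refine image_le_of_deriv_right_lt_deriv_boundary (f := fun t => u t + v t)
      (f' := fun t => (N - A * Real.exp (-2 * x t) - N / 2 * (u t * (u t + v t)))
        + (N - B * Real.exp (-2 * y t) - N / 2 * (v t * (u t + v t)))) (a := 0) (b := T)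
      (B := fun _ => 2) (B' := fun _ => 0)
      (fun t ht => ((hu t ht.1).add (hv t ht.1)).continuousAt.continuousWithinAt)
      (fun t ht => ((hu t ht.1).add (hv t ht.1)).hasDerivWithinAt) (by simp [hu0, hv0])
      (fun t => hasDerivAt_const t _) ?_ (right_mem_Icc.mpr hT)
    intro t ht heq
    beta_reduce at heq ⊢
    have h1 := mul_pos hA0 (Real.exp_pos (-2 * x t))
    have h2 := mul_pos hB0 (Real.exp_pos (-2 * y t))
    rw [heq]
    have : v t = 2 - u t := by linarith
    rw [this]
    linarith
  have hN0 : 0 < N := by linarith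
  have hc : 0 < N - B := by linarith
  have hexp : ∀ z : ℝ, 0 ≤ z → Real.exp (-2 * z) ≤ 1 := fun z hz =>
    Real.exp_le_one_iff.mpr (by linarith)
  have hlu := aux_lower N (N - B) hN0 hc x u _ hxc hx1 hu (by
    intro t ht
    have h1 := hexp _ (hupos t ht).2
    have h2 := mul_le_mul_of_nonneg_left h1 hA0.le
    have h3 := mul_le_mul_of_nonneg_left (hp2 t ht) (hupos t ht).1
    have h4 := mul_le_mul_of_nonneg_left h3 hN0.le
    linarith) hx0 hu0
  have hlv := aux_lower N (N - B) hN0 hc y v _ hyc hy1 hv (by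
    intro t ht
    have h1 := hexp _ (hvpos t ht).2
    have h2 := mul_le_mul_of_nonneg_left h1 hB0.le
    have h3 := mul_le_mul_of_nonneg_left (hp2 t ht) (hvpos t ht).1
    have h4 := mul_le_mul_of_nonneg_left h3 hN0.le
    linarith) hy0 hv0
  set κ : ℝ := (N - B) / N with hκdef
  have hκ : 0 < κ := div_pos hc hN0
  have hdec : ∀ z t : ℝ, 0 ≤ t → κ * t - κ / N ≤ z →
      Real.exp (-2 * z) ≤ Real.exp (2 * κ / N) * Real.exp (-κ * t) := by
    intro z t ht hz
    rw [← Real.exp_add]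
    apply Real.exp_le_exp.mpr
    have : 0 ≤ κ * t := by positivity
    have e : 2 * κ / N = 2 * (κ / N) := by ring
    rw [e]
    linarith
  set K : ℝ := 2 * (N - 1) * Real.exp (2 * κ / N) with hK
  have hK0 : 0 < K := mul_pos (by linarith) (Real.exp_pos _)
  set C : ℝ := 2 * Real.exp κ + 2 * K / κ with hCdef
  have hC2 : 2 * Real.exp κ ≤ C := by
    have : 0 < 2 * K / κ := by positivity
    linarith
  have hC0 : 0 < C := lt_of_lt_of_le (by positivity) hC2
  have hCK : 2 * K < κ * C := by
    have e : κ * C = κ * (2 * Real.exp κ) + 2 * K := by rw [hCdef]; field_simp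
    rw [e]
    have : 0 < κ * (2 * Real.exp κ) := by positivity
    linarith
  have hp : ∀ t, 1 ≤ t → κ ≤ u t + v t := by
    intro t ht
    have h1 := (hlu t (by linarith)).1
    have h2 := (hlv t (by linarith)).1
    have h3 : Real.exp (-N * t) ≤ 1 / 2 := by
      have : Real.exp (-N * t) ≤ Real.exp (-1) := Real.exp_le_exp.mpr (by nlinarith)
      have := Real.exp_neg_one_lt_half
      linarith
    nlinarith
  have hsmall : ∀ t, 0 ≤ t → t ≤ 1 → 2 ≤ C * Real.exp (-κ * t) := by
    intro t ht ht1
    have e : Real.exp κ * Real.exp (-κ * t) = Real.exp (κ * (1 - t)) := by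
      rw [← Real.exp_add]; ring_nf
    have h1 : 1 ≤ Real.exp (κ * (1 - t)) :=
      Real.one_le_exp (mul_nonneg hκ.le (by linarith))
    have h2 := mul_le_mul_of_nonneg_right hC2 (Real.exp_pos (-κ * t)).le
    rw [mul_assoc, e] at h2
    linarith
  have hw2 : ∀ t, 0 ≤ t → |u t - v t| ≤ 2 := by
    intro t ht
    have := hp2 t ht
    have := (hupos t ht).1
    have := (hvpos t ht).1
    rw [abs_le]; constructor <;> linarith
  have hfb : ∀ t, 0 ≤ t → A * Real.exp (-2 * x t) + B * Real.exp (-2 * y t)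
      ≤ K * Real.exp (-κ * t) := by
    intro t ht
    have h1 := mul_le_mul_of_nonneg_left (hdec _ t ht (hlu t ht).2) hA0.le
    have h2 := mul_le_mul_of_nonneg_left (hdec _ t ht (hlv t ht).2) hB0.le
    have e : K * Real.exp (-κ * t) = A * (Real.exp (2 * κ / N) * Real.exp (-κ * t))
      + B * (Real.exp (2 * κ / N) * Real.exp (-κ * t)) := by
      rw [← add_mul, hAB, hK]; ring
    linarith
  have hd1 := aux_decay N κ K C hN hκ hC0 hCK (fun t => u t - v t)
    (fun t => B * Real.exp (-2 * y t) - A * Real.exp (-2 * x t)) (fun t => u t + v t)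
    (by
      intro t ht
      refine ((hu t ht).sub (hv t ht)).congr_deriv ?_
      beta_reduce
      ring)
    (by
      intro t ht
      have := hfb t ht
      have := mul_pos hA0 (Real.exp_pos (-2 * x t))
      beta_reduce
      linarith) hp
    (by
      have := (abs_le.mp (hw2 1 zero_le_one)).2
      have := hsmall 1 zero_le_one le_rfl
      beta_reduce
      linarith)
  have hd2 := aux_decay N κ K C hN hκ hC0 hCK (fun t => v t - u t)
    (fun t => A * Real.exp (-2 * x t) - B * Real.exp (-2 * y t)) (fun t => u t + v t)
    (by
      intro t ht
      refine ((hv t ht).sub (hu t ht)).congr_deriv ?_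
      beta_reduce
      ring)
    (by
      intro t ht
      have := hfb t ht
      have := mul_pos hB0 (Real.exp_pos (-2 * y t))
      beta_reduce
      linarith) hp
    (by
      have := (abs_le.mp (hw2 1 zero_le_one)).1
      have := hsmall 1 zero_le_one le_rfl
      beta_reduce
      linarith)
  refine ⟨C, hC0, κ, hκ, fun t ht => ?_⟩
  rcases le_total t 1 with h | h
  · exact (hw2 t ht).trans (hsmall t ht h)
  · have h1 := hd1 t h
    have h2 := hd2 t h
    beta_reduce at h1 h2
    rw [abs_le]
    constructor <;> linarith
end

section
/- Let n ≥ 3 be an integer and let s be a real number with 1/2 < s < (n−1)/n. Then there is no pair of twice continuously differentiable functions x, y : [0,∞) → ℝ satisfying the system (S_s) for all t ≥ 0 with zero initial data; i.e., the solution with zero initial data blows up in finite time. -/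
open Real Set Filter

theorem right_lt_of_deriv_neg {g : ℝ → ℝ} {d a : ℝ} (h : HasDerivAt g d a) (hd : d < 0) :
    ∃ b, a < b ∧ ∀ r ∈ Ioo a b, g r < g a := by
  have h1 := (hasDerivAt_iff_tendsto_slope.1 h).mono_left
    (nhdsWithin_mono a (fun r (hr : a < r) => (ne_of_gt hr : r ≠ a)))
  have h2 : ∀ᶠ r in nhdsWithin a (Ioi a), slope g a r < 0 := h1.eventually (gt_mem_nhds hd)
  obtain ⟨b, hb, hb2⟩ := (mem_nhdsGT_iff_exists_Ioo_subset).1 h2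
  refine ⟨b, hb, fun r hr => ?_⟩
  have h3 : slope g a r < 0 := hb2 hr
  rw [slope_def_field, div_lt_iff₀ (by linarith [hr.1])] at h3
  linarith

theorem anti_of_le {g g' : ℝ → ℝ} {a : ℝ} (hc : ContinuousOn g (Ici a))
    (hd : ∀ t, a < t → HasDerivAt g (g' t) t) (hn : ∀ t, a < t → g' t ≤ 0) :
    AntitoneOn g (Ici a) := by
  apply antitoneOn_of_deriv_nonpos (convex_Ici a) hc
  · intro t ht
    rw [interior_Ici] at ht
    exact (hd t ht).differentiableAt.differentiableWithinAt
  · intro t ht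
    rw [interior_Ici] at ht
    rw [(hd t ht).deriv]
    exact hn t ht

theorem core_blowup (N A B : ℝ) (hN : 3 ≤ N) (hA : N < A) (hB : 0 < B)
    (x y u v : ℝ → ℝ) (hxc : ContinuousOn x (Ici 0))
    (hx : ∀ t, 0 < t → HasDerivAt x (u t) t)
    (hu : ∀ t, 0 ≤ t → HasDerivAt u
      (N - A * exp (-2 * x t) - N / 2 * (u t ^ 2 + u t * v t)) t)
    (hv : ∀ t, 0 ≤ t → HasDerivAt v
      (N - B * exp (-2 * y t) - N / 2 * (v t ^ 2 + u t * v t)) t)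
    (x0 : x 0 = 0) (u0 : u 0 = 0) (v0 : v 0 = 0) : False := by
  have huc : ContinuousOn u (Ici 0) := fun t ht => (hu t ht).continuousAt.continuousWithinAt
  have hu_nonpos : ∀ t, 0 ≤ t → u t ≤ 0 := by
    intro t1 ht1
    by_contra hpos
    push Not at hpos
    have ht1' : 0 < t1 := by
      rcases ht1.eq_or_lt with h | h
      · rw [← h, u0] at hpos; exact absurd hpos (lt_irrefl _)
      · exact h
    obtain ⟨m, hm, hmin⟩ := isCompact_Icc.exists_isMinOn (nonempty_Icc.2 ht1)
      (hxc.mono (Icc_subset_Ici_self : Icc 0 t1 ⊆ Ici 0))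
    have hmin' : ∀ r, 0 ≤ r → r ≤ t1 → x m ≤ x r := fun r h1 h2 => hmin ⟨h1, h2⟩
    have hmt : m < t1 := by
      rcases hm.2.eq_or_lt with h | h
      · exfalso
        subst h
        have hneg : HasDerivAt (fun r => x (-r)) (-(u m)) (-m) := by
          have := HasDerivAt.scomp (h := fun r : ℝ => -r) (-m)
            (by simpa using hx m ht1') (hasDerivAt_neg (-m))
          simpa [Function.comp_def] using this
        obtain ⟨b, hb, hb2⟩ := right_lt_of_deriv_neg hneg (by linarith)
        obtain ⟨r, hr1, hr2⟩ := exists_between (lt_min hb (by linarith : -m < 0))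
        have h3 := hb2 r ⟨hr1, hr2.trans_le (min_le_left _ _)⟩
        have h4 := hr2.trans_le (min_le_right _ _)
        have h5 := hmin' (-r) (by linarith) (by linarith)
        simp only [neg_neg] at h3
        linarith
      · exact h
    have hum : u m = 0 := by
      rcases hm.1.eq_or_lt with h | h
      · rw [← h, u0]
      · have hl : IsLocalMin x m := hmin.isLocalMin (Icc_mem_nhds h hmt)
        exact hl.hasDerivAt_eq_zero (hx m h)
    have hxm : x m ≤ 0 := x0 ▸ hmin' 0 le_rfl ht1
    have hexp : 1 ≤ exp (-2 * x m) := one_le_exp (by linarith)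
    obtain ⟨b, hb, hb2⟩ := right_lt_of_deriv_neg (hu m hm.1) (by rw [hum]; nlinarith)
    obtain ⟨r, hr1, hr2⟩ := exists_between (lt_min hb hmt)
    have hrb := hr2.trans_le (min_le_left _ _)
    have hrt := hr2.trans_le (min_le_right _ _)
    have hanti : StrictAntiOn x (Icc m r) := by
      apply strictAntiOn_of_deriv_neg (convex_Icc m r)
      · exact hxc.mono (fun q hq => hm.1.trans hq.1)
      · intro q hq
        rw [interior_Icc] at hq
        rw [(hx q (hm.1.trans_lt hq.1)).deriv]
        have := hb2 q ⟨hq.1, hq.2.trans hrb⟩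
        linarith
    have h6 := hanti (left_mem_Icc.2 hr1.le) (right_mem_Icc.2 hr1.le) hr1
    have h7 := hmin' r (hm.1.trans hr1.le) hrt.le
    linarith
  have hxanti : AntitoneOn x (Ici 0) :=
    anti_of_le hxc hx (fun t ht => hu_nonpos t ht.le)
  have hx_nonpos : ∀ t, 0 ≤ t → x t ≤ 0 := fun t ht =>
    x0 ▸ hxanti (mem_Ici.2 le_rfl) (mem_Ici.2 ht) ht
  have hw : ∀ t, 0 ≤ t → HasDerivAt (fun r => u r + v r)
      (2 * N - A * exp (-2 * x t) - B * exp (-2 * y t) - N / 2 * (u t + v t) ^ 2) t := by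
    intro t ht
    have h := (hu t ht).add (hv t ht)
    have he : 2 * N - A * exp (-2 * x t) - B * exp (-2 * y t) - N / 2 * (u t + v t) ^ 2
        = (N - A * exp (-2 * x t) - N / 2 * (u t ^ 2 + u t * v t))
          + (N - B * exp (-2 * y t) - N / 2 * (v t ^ 2 + u t * v t)) := by ring
    rw [he]
    exact h
  have hw2 : ∀ t, 0 ≤ t → u t + v t ≤ 2 := by
    intro t ht
    refine image_le_of_deriv_right_lt_deriv_boundary (a := 0) (b := t)
      (f := fun r => u r + v r) (B := fun _ => 2) (B' := fun _ => 0)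
      (fun r hr => (hw r hr.1).continuousAt.continuousWithinAt)
      (fun r hr => (hw r hr.1).hasDerivWithinAt) (by simp [u0, v0])
      (fun r => hasDerivAt_const r 2) ?_ (right_mem_Icc.2 ht)
    intro r hr heq
    have heq' : u r + v r = 2 := heq
    have hexp : 1 ≤ exp (-2 * x r) := one_le_exp (by linarith [hx_nonpos r hr.1])
    have hB2 : 0 < B * exp (-2 * y r) := by positivity
    rw [heq']
    nlinarith
  obtain ⟨c, hc⟩ : ∃ c, c = A - N := ⟨_, rfl⟩
  have hc0 : 0 < c := by linarith
  have hG : AntitoneOn (fun t => u t + N * x t + c * t) (Ici 0) := by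
    apply anti_of_le (g' := fun t => (N - A * exp (-2 * x t)
      - N / 2 * (u t ^ 2 + u t * v t)) + N * u t + c * 1)
    · fun_prop
    · intro t ht
      exact ((hu t ht.le).add ((hx t ht).const_mul N)).add ((hasDerivAt_id t).const_mul c)
    · intro t ht
      have hexp : 1 ≤ exp (-2 * x t) := one_le_exp (by linarith [hx_nonpos t ht.le])
      have h1 : 0 ≤ (-u t) * (2 - (u t + v t)) :=
        mul_nonneg (by linarith [hu_nonpos t ht.le]) (by linarith [hw2 t ht.le])
      have h2 : 0 ≤ N / 2 * ((-u t) * (2 - (u t + v t))) := mul_nonneg (by linarith) h1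
      have h3 : A ≤ A * exp (-2 * x t) := by nlinarith
      nlinarith
  have hG' : ∀ t, 0 ≤ t → u t + N * x t + c * t ≤ 0 := by
    intro t ht
    have := hG (mem_Ici.2 le_rfl) (mem_Ici.2 ht) ht
    simpa [u0, x0] using this
  obtain ⟨T, hT0, hT⟩ : ∃ T, 0 ≤ T ∧ x T ≤ -1 := by
    by_contra hcon
    push Not at hcon
    have hH : AntitoneOn (fun t => x t + c / 2 * t ^ 2 - N * t) (Ici 0) := by
      apply anti_of_le (g' := fun t => u t + c / 2 * (2 * t) - N * 1)
      · fun_prop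
      · intro t ht
        have h2 : HasDerivAt (fun r : ℝ => r ^ 2) (2 * t) t := by simpa using hasDerivAt_pow 2 t
        exact ((hx t ht).add (h2.const_mul (c / 2))).sub ((hasDerivAt_id t).const_mul N)
      · intro t ht
        have h1 := hG' t ht.le
        have h2 := hcon t ht.le
        nlinarith
    obtain ⟨t, htd⟩ : ∃ t, t = (2 * N + 2) / c + 1 := ⟨_, rfl⟩
    have ht1 : 1 ≤ t := by
      have : 0 ≤ (2 * N + 2) / c := by positivity
      linarith
    have hct : c * t = 2 * N + 2 + c := by rw [htd]; field_simp
    have h1 := hH (mem_Ici.2 le_rfl) (mem_Ici.2 (by linarith : (0:ℝ) ≤ t)) (by linarith)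
    have h2 := hcon t (by linarith)
    simp only [x0] at h1
    have h3 : c / 2 * t ^ 2 = (2 * N + 2 + c) / 2 * t := by rw [← hct]; ring
    rw [h3] at h1
    nlinarith
  have hF : AntitoneOn (fun t => arctan (u t + v t) + t) (Ici T) := by
    have hd : ∀ t, 0 ≤ t → HasDerivAt (fun t => arctan (u t + v t) + t) _ t := fun t ht =>
      ((hw t ht).arctan).add (hasDerivAt_id t)
    apply anti_of_le (fun t ht => (hd t (hT0.trans ht)).continuousAt.continuousWithinAt)
      (fun t ht => hd t (hT0.trans ht.le))
    intro t ht
    have hxt : x t ≤ -1 := (hxanti hT0 (hT0.trans ht.le : (0:ℝ) ≤ t) ht.le).trans hT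
    have hexp : 3 ≤ exp (-2 * x t) := by
      have := add_one_le_exp (-2 * x t)
      linarith
    have hB2 : 0 < B * exp (-2 * y t) := by positivity
    have hA3 : 3 * N ≤ A * exp (-2 * x t) := by nlinarith
    have hq : 0 < 1 + (u t + v t) ^ 2 := by positivity
    have hkey : 2 * N - A * exp (-2 * x t) - B * exp (-2 * y t) - N / 2 * (u t + v t) ^ 2
        ≤ -(1 + (u t + v t) ^ 2) := by nlinarith [sq_nonneg (u t + v t)]
    have h8 : 1 / (1 + (u t + v t) ^ 2) * (2 * N - A * exp (-2 * x t) - B * exp (-2 * y t)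
        - N / 2 * (u t + v t) ^ 2) ≤ -1 := by
      rw [one_div, ← div_eq_inv_mul, div_le_iff₀ hq]
      linarith
    linarith
  have h9 := hF (mem_Ici.2 le_rfl) (mem_Ici.2 (by linarith : T ≤ T + 4)) (by linarith)
  simp only at h9
  have h10 := neg_pi_div_two_lt_arctan (u (T + 4) + v (T + 4))
  have h11 := arctan_lt_pi_div_two (u T + v T)
  linarith [pi_lt_four]

theorem hasDerivAt_of_c2 {x : ℝ → ℝ} (hx : ContDiffOn ℝ 2 x (Ici (0 : ℝ))) {t : ℝ}
    (ht : 0 < t) : HasDerivAt x (deriv x t) t ∧ DifferentiableAt ℝ (deriv x) t := by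
  have h : ContDiffAt ℝ 2 x t := hx.contDiffAt (Ici_mem_nhds ht)
  refine ⟨(h.differentiableAt (by norm_num)).hasDerivAt, ?_⟩
  have h2 : ContDiffAt ℝ 1 (deriv x) t := by
    have h3 : ContDiffOn ℝ 1 (deriv x) (Ioi 0) :=
      (hx.mono Ioi_subset_Ici_self).deriv_of_isOpen isOpen_Ioi (by norm_num)
    exact h3.contDiffAt (Ioi_mem_nhds ht)
  exact h2.differentiableAt (by norm_num)

/-- For `n ≥ 3` and `1/2 < s < (n−1)/n` there is no global (on `[0,∞)`) C² solution of
the system `(S_s)` with zero initial data: the solution blows up in finite time. -/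
theorem no_global_solution_small_s
    (n : ℕ) (hn : 3 ≤ n) (s : ℝ) (hs1 : 1 / 2 < s) (hs2 : s < ((n : ℝ) - 1) / (n : ℝ)) :
    ¬ ∃ x y : ℝ → ℝ,
        ContDiffOn ℝ 2 x (Ici (0 : ℝ)) ∧ ContDiffOn ℝ 2 y (Ici (0 : ℝ)) ∧
        SysS n s x y (Ici (0 : ℝ)) ∧ ZeroInit x y := by
  rintro ⟨x, y, hx, hy, hS, x0, y0, u0, v0⟩
  have hN : (3 : ℝ) ≤ n := by exact_mod_cast hn
  have hs0 : 0 < s := by linarith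
  rw [lt_div_iff₀ (by linarith)] at hs2
  have hA : (n : ℝ) < 1 / s * ((n : ℝ) - 1) := by
    rw [one_div, ← div_eq_inv_mul, lt_div_iff₀ hs0]; linarith
  have hB' : 0 < 2 - 1 / s := by
    have : 1 / s < 2 := by rw [div_lt_iff₀ hs0]; linarith
    linarith
  have hB : 0 < (2 - 1 / s) * ((n : ℝ) - 1) := mul_pos hB' (by linarith)
  have hS0 := hS 0 (mem_Ici.2 le_rfl)
  simp only [x0, y0, u0, v0, mul_zero, exp_zero, mul_one] at hS0
  have hdx : ∀ t, 0 ≤ t → DifferentiableAt ℝ (deriv x) t := by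
    intro t ht
    rcases ht.eq_or_lt with h | h
    · subst h
      by_contra hnd
      have := deriv_zero_of_not_differentiableAt hnd
      linarith [hS0.1]
    · exact (hasDerivAt_of_c2 hx h).2
  have hdy : ∀ t, 0 ≤ t → DifferentiableAt ℝ (deriv y) t := by
    intro t ht
    rcases ht.eq_or_lt with h | h
    · subst h
      by_contra hnd
      have := deriv_zero_of_not_differentiableAt hnd
      linarith [hS0.2]
    · exact (hasDerivAt_of_c2 hy h).2
  refine core_blowup n _ _ hN hA hB x y (deriv x) (deriv y) hx.continuousOn
    (fun t ht => (hasDerivAt_of_c2 hx ht).1) ?_ ?_ x0 u0 v0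
  · intro t ht
    rw [← (hS t ht).1]
    exact (hdx t ht).hasDerivAt
  · intro t ht
    rw [← (hS t ht).2]
    exact (hdy t ht).hasDerivAt
end

section
/- Let n ≥ 3 be an integer and let s be a real number with (n−1)/n ≤ s ≤ (n−1)/(n−2). Then there exists a pair of twice continuously differentiable functions x, y : ℝ → ℝ satisfying the system (S_s) for all t ∈ ℝ with zero initial data, and this solution is even in time: x(−t) = x(t) and y(−t) = y(t) for all t ∈ ℝ. -/
open Real Set Filter

open scoped NNReal Topology

/-- Global existence for bounded, globally Lipschitz autonomous vector fields. -/
theorem global_exists_aux {E : Type*} [NormedAddCommGroup E] [NormedSpace ℝ E] [CompleteSpace E]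
    (F : E → E) (K L : ℝ≥0) (hK : LipschitzWith K F) (hL : ∀ p, ‖F p‖ ≤ L) (p₀ : E) :
    ∃ γ : ℝ → E, γ 0 = p₀ ∧ ∀ t, HasDerivAt γ (F (γ t)) t := by
  have loc : ∀ k : ℕ, ∃ α : ℝ → E, α 0 = p₀ ∧
      ∀ t ∈ Ioo (-((k : ℝ) + 1)) ((k : ℝ) + 1), HasDerivAt α (F (α t)) t := by
    intro k
    have hk : (0 : ℝ) ≤ (k : ℝ) + 1 := by positivity
    have hmem : (0 : ℝ) ∈ Icc (-((k : ℝ) + 1)) ((k : ℝ) + 1) := ⟨by linarith, hk⟩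
    have hP : IsPicardLindelof (fun _ : ℝ => F) (⟨0, hmem⟩ : Icc (-((k : ℝ) + 1)) ((k : ℝ) + 1))
        p₀ (L * ((k : ℝ≥0) + 1)) 0 L K := by
      apply IsPicardLindelof.of_time_independent
      · intro x _; exact hL x
      · exact hK.lipschitzOnWith
      · simp
    obtain ⟨α, h0, hα⟩ := hP.exists_eq_forall_mem_Icc_hasDerivWithinAt₀
    refine ⟨α, h0, fun t ht => (hα t (Ioo_subset_Icc_self ht)).hasDerivAt (Icc_mem_nhds ht.1 ht.2)⟩
  choose α h0 hα using loc
  have agree : ∀ j k : ℕ, j ≤ k → EqOn (α j) (α k) (Ioo (-((j : ℝ) + 1)) ((j : ℝ) + 1)) := by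
    intro j k hjk
    have hjk' : (j : ℝ) ≤ k := by exact_mod_cast hjk
    have hj : (0 : ℝ) < (j : ℝ) + 1 := by positivity
    refine ODE_solution_unique_of_mem_Ioo (v := fun _ => F) (K := K) (s := fun _ => univ) (t₀ := 0)
      (fun t _ => hK.lipschitzOnWith) ⟨by linarith, hj⟩ (fun t ht => ⟨hα j t ht, trivial⟩)
      (fun t ht => ⟨hα k t ⟨by linarith [ht.1], by linarith [ht.2]⟩, trivial⟩) ?_
    rw [h0, h0]
  have key : ∀ (k : ℕ) (t : ℝ), t ∈ Ioo (-((k : ℝ) + 1)) ((k : ℝ) + 1) →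
      α ⌈|t|⌉₊ t = α k t := by
    intro k t ht
    have h1 : |t| ≤ ⌈|t|⌉₊ := Nat.le_ceil _
    have h2 := abs_le.1 h1
    rcases le_total ⌈|t|⌉₊ k with h | h
    · exact agree _ _ h ⟨by linarith [h2.1], by linarith [h2.2]⟩
    · exact (agree _ _ h ht).symm
  refine ⟨fun t => α ⌈|t|⌉₊ t, by simp [h0], fun t => ?_⟩
  have h1 : |t| ≤ ⌈|t|⌉₊ := Nat.le_ceil _
  have h2 := abs_le.1 h1
  have ht : t ∈ Ioo (-((⌈|t|⌉₊ : ℝ) + 1)) ((⌈|t|⌉₊ : ℝ) + 1) :=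
    ⟨by linarith [h2.1], by linarith [h2.2]⟩
  refine (hα _ t ht).congr_of_eventuallyEq ?_
  filter_upwards [Ioo_mem_nhds ht.1 ht.2] with r hr
  exact key _ r hr

/-- Clamp to `[-2, 2]`. -/
noncomputable def clampTwo (u : ℝ) : ℝ := max (-2) (min 2 u)

theorem clampTwo_bd (u : ℝ) : |clampTwo u| ≤ 2 := by
  unfold clampTwo; rw [abs_le]; constructor
  · exact le_max_left _ _
  · exact max_le (by norm_num) (min_le_left _ _)

theorem clampTwo_lip (u v : ℝ) : |clampTwo u - clampTwo v| ≤ |u - v| := by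
  unfold clampTwo
  calc _ ≤ |min 2 u - min 2 v| := by
        rw [max_comm (-2), max_comm (-2)]; exact abs_max_sub_max_le_abs _ _ _
    _ ≤ |u - v| := by
      have := abs_min_sub_min_le_max 2 u 2 v
      simpa using this

theorem clampTwo_neg (u : ℝ) : clampTwo (-u) = -clampTwo u := by
  unfold clampTwo; grind

theorem clampTwo_of_mem {u : ℝ} (h1 : -2 ≤ u) (h2 : u ≤ 2) : clampTwo u = u := by
  unfold clampTwo; rw [min_eq_right h2, max_eq_right h1]

theorem clampTwo_nonneg {u : ℝ} (h : 0 ≤ u) : 0 ≤ clampTwo u := by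
  unfold clampTwo; exact le_max_of_le_right (le_min (by norm_num) h)

theorem clampTwo_abs_le (u : ℝ) : |clampTwo u| ≤ |u| := by
  have := clampTwo_lip u 0
  rwa [clampTwo_of_mem (u := 0) (by norm_num) (by norm_num), sub_zero, sub_zero] at this

theorem exp_lip_aux {A B : ℝ} (hA : 0 ≤ A) (hB : 0 ≤ B) :
    |exp (-A) - exp (-B)| ≤ |A - B| := by
  wlog h : A ≤ B generalizing A B
  · have := this hB hA (le_of_not_ge h)
    rwa [abs_sub_comm, abs_sub_comm A]
  have h1 : exp (-B) ≤ exp (-A) := exp_le_exp.2 (by linarith)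
  rw [abs_of_nonneg (by linarith), abs_sub_comm, abs_of_nonneg (by linarith)]
  have h2 : exp (-B) = exp (-A) * exp (-(B - A)) := by rw [← exp_add]; ring_nf
  have h3 : -(B - A) + 1 ≤ exp (-(B - A)) := add_one_le_exp _
  have h4 : exp (-A) ≤ 1 := exp_le_one_iff.2 (by linarith)
  have h5 : 0 < exp (-A) := exp_pos _
  rw [h2]
  nlinarith [mul_le_mul_of_nonneg_left h3 h5.le, mul_nonneg (sub_nonneg.2 h) (sub_nonneg.2 h4)]

/-- Truncated acceleration. -/
noncomputable def accel (m a x u v : ℝ) : ℝ :=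
  m - a * exp (-(2 * max x 0)) - m / 2 * (clampTwo u ^ 2 + clampTwo u * clampTwo v)

theorem exp_bd (x : ℝ) : exp (-(2 * max x 0)) ≤ 1 :=
  exp_le_one_iff.2 (by linarith [le_max_right x 0])

theorem accel_bd {m a : ℝ} (hm : 0 ≤ m) (ha : 0 ≤ a) (x u v : ℝ) :
    |accel m a x u v| ≤ 5 * m + a := by
  unfold accel
  have hu := abs_le.1 (clampTwo_bd u)
  have hv := abs_le.1 (clampTwo_bd v)
  have he := exp_bd x
  have he0 := exp_pos (-(2 * max x 0))
  generalize clampTwo u = U at *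
  generalize clampTwo v = V at *
  generalize exp (-(2 * max x 0)) = e at *
  have h1 : a * e ≤ a := by nlinarith
  have h2 : 0 ≤ a * e := by positivity
  have h3 : U ^ 2 + U * V ≤ 8 := by nlinarith
  have h4 : -8 ≤ U ^ 2 + U * V := by nlinarith
  have h5 := mul_le_mul_of_nonneg_left h3 (by positivity : 0 ≤ m / 2)
  have h6 := mul_le_mul_of_nonneg_left h4 (by positivity : 0 ≤ m / 2)
  rw [abs_le]; constructor <;> linarith

theorem accel_lip {m a : ℝ} (hm : 0 ≤ m) (ha : 0 ≤ a) {x u v x' u' v' d : ℝ}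
    (hx : |x - x'| ≤ d) (hu : |u - u'| ≤ d) (hv : |v - v'| ≤ d) :
    |accel m a x u v - accel m a x' u' v'| ≤ (2 * a + 4 * m) * d := by
  have e1 : |exp (-(2 * max x 0)) - exp (-(2 * max x' 0))| ≤ 2 * d := by
    refine (exp_lip_aux (by positivity) (by positivity)).trans ?_
    rw [← mul_sub, abs_mul, abs_two]
    have := abs_max_sub_max_le_abs x x' 0
    linarith
  have c1 := (clampTwo_lip u u').trans hu
  have c2 := (clampTwo_lip v v').trans hv
  have hU := clampTwo_bd u
  have hU' := clampTwo_bd u'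
  have hV := clampTwo_bd v
  have hd : 0 ≤ d := (abs_nonneg _).trans hx
  unfold accel
  generalize clampTwo u = U at *
  generalize clampTwo v = V at *
  generalize clampTwo u' = U' at *
  generalize clampTwo v' = V' at *
  generalize exp (-(2 * max x 0)) = e at *
  generalize exp (-(2 * max x' 0)) = e' at *
  have q : |(U ^ 2 + U * V) - (U' ^ 2 + U' * V')| ≤ 8 * d := by
    have : (U ^ 2 + U * V) - (U' ^ 2 + U' * V')
        = U * (U - U') + U' * (U - U') + V * (U - U') + U' * (V - V') := by ring
    rw [this]
    have b : ∀ p q : ℝ, |p| ≤ 2 → |q| ≤ d → |p * q| ≤ 2 * d := fun p q hp hq => by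
      rw [abs_mul]; exact mul_le_mul hp hq (abs_nonneg _) (by norm_num)
    have b1 := abs_le.1 (b _ _ hU c1)
    have b2 := abs_le.1 (b _ _ hU' c1)
    have b3 := abs_le.1 (b _ _ hV c1)
    have b4 := abs_le.1 (b _ _ hU' c2)
    rw [abs_le]; constructor <;> linarith
  have e2 := abs_le.1 e1
  have q2 := abs_le.1 q
  have a1 := mul_le_mul_of_nonneg_left e2.1 ha
  have a2 := mul_le_mul_of_nonneg_left e2.2 ha
  have m1 := mul_le_mul_of_nonneg_left q2.1 (by positivity : 0 ≤ m / 2)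
  have m2 := mul_le_mul_of_nonneg_left q2.2 (by positivity : 0 ≤ m / 2)
  rw [abs_le]; constructor <;> nlinarith

/-- Truncated vector field; state `(x, u, y, v)`. -/
noncomputable def truncField (m a b : ℝ) (p : ℝ × ℝ × ℝ × ℝ) : ℝ × ℝ × ℝ × ℝ :=
  (clampTwo p.2.1, accel m a p.1 p.2.1 p.2.2.2, clampTwo p.2.2.2, accel m b p.2.2.1 p.2.2.2 p.2.1)

theorem truncField_bd {m a b : ℝ} (hm : 0 ≤ m) (ha : 0 ≤ a) (hb : 0 ≤ b) (p : ℝ × ℝ × ℝ × ℝ) :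
    ‖truncField m a b p‖ ≤ 2 + 5 * m + a + b := by
  simp only [truncField, Prod.norm_def, Real.norm_eq_abs]
  have := clampTwo_bd p.2.1
  have := clampTwo_bd p.2.2.2
  have := accel_bd hm ha p.1 p.2.1 p.2.2.2
  have := accel_bd hm hb p.2.2.1 p.2.2.2 p.2.1
  refine max_le (by linarith) (max_le (by linarith) (max_le (by linarith) (by linarith)))

theorem truncField_lip {m a b : ℝ} (hm : 0 ≤ m) (ha : 0 ≤ a) (hb : 0 ≤ b) :
    LipschitzWith (Real.toNNReal (1 + 2 * a + 2 * b + 4 * m)) (truncField m a b) := by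
  refine LipschitzWith.of_dist_le_mul fun p q => ?_
  rw [Real.coe_toNNReal _ (by positivity)]
  have hd : 0 ≤ dist p q := dist_nonneg
  have g1 : |p.1 - q.1| ≤ dist p q := by
    rw [Prod.dist_eq, ← Real.dist_eq]; exact le_max_left _ _
  have g2 : |p.2.1 - q.2.1| ≤ dist p q := by
    rw [Prod.dist_eq, Prod.dist_eq, ← Real.dist_eq]; simp
  have g3 : |p.2.2.1 - q.2.2.1| ≤ dist p q := by
    rw [Prod.dist_eq, Prod.dist_eq, Prod.dist_eq, ← Real.dist_eq]; simp
  have g4 : |p.2.2.2 - q.2.2.2| ≤ dist p q := by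
    rw [Prod.dist_eq, Prod.dist_eq, Prod.dist_eq, ← Real.dist_eq]; simp
  have f1 := (clampTwo_lip p.2.1 q.2.1).trans g2
  have f2 := (clampTwo_lip p.2.2.2 q.2.2.2).trans g4
  have f3 := accel_lip hm ha g1 g2 g4
  have f4 := accel_lip hm hb g3 g4 g2
  generalize dist p q = d at *
  have := mul_nonneg ha hd
  have := mul_nonneg hb hd
  have := mul_nonneg hm hd
  simp only [truncField, Prod.dist_eq, Real.dist_eq]
  refine max_le (by nlinarith) (max_le (by nlinarith) (max_le (by nlinarith) (by nlinarith)))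

theorem accel_neg (m a x u v : ℝ) : accel m a x (-u) (-v) = accel m a x u v := by
  unfold accel; rw [clampTwo_neg, clampTwo_neg]; ring

/-- Velocity stays nonnegative. -/
theorem vel_nonneg {m a : ℝ} (hm : 0 ≤ m) (ha : 0 ≤ a) (ham : a ≤ m) {x u v : ℝ → ℝ}
    (hu : ∀ t, HasDerivAt u (accel m a (x t) (u t) (v t)) t) (h0 : u 0 = 0)
    {t : ℝ} (ht : 0 ≤ t) : 0 ≤ u t := by
  have step : ∀ ε > 0, -u t ≤ ε * exp ((2 * m + 1) * t) := by
    intro ε hε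
    refine image_le_of_deriv_right_lt_deriv_boundary (f := fun t => -u t)
      (f' := fun t => -accel m a (x t) (u t) (v t)) (a := 0) (b := t)
      (B := fun t => ε * exp ((2 * m + 1) * t))
      (B' := fun t => ε * (exp ((2 * m + 1) * t) * (2 * m + 1)))
      (fun r _ => (hu r).neg.continuousAt.continuousWithinAt)
      (fun r _ => (hu r).neg.hasDerivWithinAt) (by simp [h0, hε.le]) ?_ ?_ ⟨ht, le_rfl⟩
    · intro r
      have : HasDerivAt (fun t : ℝ => (2 * m + 1) * t) (2 * m + 1) r := by
        simpa using (hasDerivAt_id r).const_mul (2 * m + 1)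
      exact this.exp.const_mul ε
    · intro r _ hr
      have hB : 0 < ε * exp ((2 * m + 1) * r) := by positivity
      rw [← mul_assoc]
      rw [← hr] at hB ⊢
      unfold accel
      have h1 := clampTwo_abs_le (u r)
      rw [abs_of_neg (by linarith : u r < 0)] at h1
      have h2 := clampTwo_bd (u r)
      have h3 := clampTwo_bd (v r)
      have he := exp_bd (x r)
      have he0 := exp_pos (-(2 * max (x r) 0))
      generalize clampTwo (u r) = U at *
      generalize clampTwo (v r) = V at *
      generalize exp (-(2 * max (x r) 0)) = e at *
      have h4 : U ^ 2 + U * V ≤ -u r * 4 := by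
        have : U ^ 2 + U * V = U * (U + V) := by ring
        rw [this]
        refine (le_abs_self _).trans ?_
        rw [abs_mul]
        refine mul_le_mul h1 ((abs_add_le _ _).trans (by linarith)) (abs_nonneg _) hB.le
      have h5 := mul_le_mul_of_nonneg_left h4 (by positivity : 0 ≤ m / 2)
      have h6 : a * e ≤ m := by nlinarith
      nlinarith
  by_contra hneg
  push Not at hneg
  have hpos := exp_pos ((2 * m + 1) * t)
  have := step (-u t / 2 / exp ((2 * m + 1) * t)) (by apply div_pos; linarith; exact hpos)
  rw [div_mul_cancel₀ _ hpos.ne'] at this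
  linarith

theorem vel_le {m a : ℝ} (hm : 0 < m) (ha : 0 ≤ a) {x u v : ℝ → ℝ}
    (hu : ∀ t, HasDerivAt u (accel m a (x t) (u t) (v t)) t) (h0 : u 0 = 0)
    (hv : ∀ t, 0 ≤ t → 0 ≤ v t)
    {t : ℝ} (ht : 0 ≤ t) : u t ≤ 2 := by
  refine image_le_of_deriv_right_lt_deriv_boundary (f := u)
      (f' := fun t => accel m a (x t) (u t) (v t)) (a := 0) (b := t)
      (B := fun _ => 2) (B' := fun _ => 0)
      (fun r _ => (hu r).continuousAt.continuousWithinAt)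
      (fun r _ => (hu r).hasDerivWithinAt) (by simp [h0])
      (fun r => hasDerivAt_const _ _) ?_ ⟨ht, le_rfl⟩
  intro r hr hur
  rw [hur]
  unfold accel
  rw [clampTwo_of_mem (u := 2) (by norm_num) le_rfl]
  have h1 := clampTwo_nonneg (hv r hr.1)
  have he0 := exp_pos (-(2 * max (x r) 0))
  have := mul_nonneg ha he0.le
  have := mul_nonneg hm.le h1
  nlinarith

theorem pos_nonneg {x u : ℝ → ℝ} (hx : ∀ t, HasDerivAt x (clampTwo (u t)) t) (h0 : x 0 = 0)
    (hu : ∀ t, 0 ≤ t → 0 ≤ u t) {t : ℝ} (ht : 0 ≤ t) : 0 ≤ x t := by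
  have : MonotoneOn x (Ici 0) := by
    apply monotoneOn_of_deriv_nonneg (convex_Ici 0)
    · exact fun r _ => (hx r).continuousAt.continuousWithinAt
    · exact fun r _ => (hx r).differentiableAt.differentiableWithinAt
    · intro r hr
      rw [interior_Ici] at hr
      rw [(hx r).deriv]
      exact clampTwo_nonneg (hu r (le_of_lt hr))
  have := this (mem_Ici.2 le_rfl) (mem_Ici.2 ht) ht
  linarith

theorem sys_aux (m a b : ℝ) (hm : 0 < m) (ha : 0 ≤ a) (ham : a ≤ m) (hb : 0 ≤ b) (hbm : b ≤ m) :
    ∃ x u y v : ℝ → ℝ, x 0 = 0 ∧ u 0 = 0 ∧ y 0 = 0 ∧ v 0 = 0 ∧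
      (∀ t, HasDerivAt x (u t) t) ∧ (∀ t, HasDerivAt y (v t) t) ∧
      (∀ t, HasDerivAt u (m - a * exp (-2 * x t) - m / 2 * (u t ^ 2 + u t * v t)) t) ∧
      (∀ t, HasDerivAt v (m - b * exp (-2 * y t) - m / 2 * (v t ^ 2 + u t * v t)) t) ∧
      (∀ t, x (-t) = x t) ∧ (∀ t, y (-t) = y t) := by
  have hlip := truncField_lip hm.le ha hb
  obtain ⟨γ, h0, hγ⟩ := global_exists_aux (truncField m a b) _
    (Real.toNNReal (2 + 5 * m + a + b)) hlip
    (fun p => (truncField_bd hm.le ha hb p).trans (Real.le_coe_toNNReal _)) (0, 0, 0, 0)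
  set x : ℝ → ℝ := fun t => (γ t).1 with hxdef
  set u : ℝ → ℝ := fun t => (γ t).2.1 with hudef
  set y : ℝ → ℝ := fun t => (γ t).2.2.1 with hydef
  set v : ℝ → ℝ := fun t => (γ t).2.2.2 with hvdef
  have hx : ∀ t, HasDerivAt x (clampTwo (u t)) t := fun t => (hγ t).fst
  have hu : ∀ t, HasDerivAt u (accel m a (x t) (u t) (v t)) t := fun t => (hγ t).snd.fst
  have hy : ∀ t, HasDerivAt y (clampTwo (v t)) t := fun t => (hγ t).snd.snd.fst
  have hv : ∀ t, HasDerivAt v (accel m b (y t) (v t) (u t)) t := fun t => (hγ t).snd.snd.snd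
  have x0 : x 0 = 0 := by simp [hxdef, h0]
  have u0 : u 0 = 0 := by simp [hudef, h0]
  have y0 : y 0 = 0 := by simp [hydef, h0]
  have v0 : v 0 = 0 := by simp [hvdef, h0]
  -- reflection
  have comp_neg : ∀ {f : ℝ → ℝ} {f' t : ℝ}, HasDerivAt f f' (-t) →
      HasDerivAt (fun r => f (-r)) (-f') t := by
    intro f f' t h
    have := h.comp t (hasDerivAt_neg t)
    simpa [Function.comp_def] using this
  have hrefl : γ = fun t => (x (-t), -u (-t), y (-t), -v (-t)) := by
    refine ODE_solution_unique_univ (v := fun _ => truncField m a b) (s := fun _ => univ)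
      (t₀ := 0) (fun _ => hlip.lipschitzOnWith) (fun t => ⟨hγ t, trivial⟩)
      (fun t => ⟨?_, trivial⟩) ?_
    · simp only [truncField, accel_neg, clampTwo_neg]
      refine (comp_neg (hx (-t))).prodMk (HasDerivAt.prodMk ?_ (HasDerivAt.prodMk
        (comp_neg (hy (-t))) ?_))
      · have := (comp_neg (hu (-t))).neg
        rw [neg_neg] at this
        exact this
      · have := (comp_neg (hv (-t))).neg
        rw [neg_neg] at this
        exact this
    · simp [h0, x0, u0, y0, v0]
  have ex : ∀ t, x (-t) = x t := fun t => by
    have := congrArg (fun p => p.1) (congrFun hrefl t); exact this.symm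
  have eu : ∀ t, -u (-t) = u t := fun t => by
    have := congrArg (fun p => p.2.1) (congrFun hrefl t); exact this.symm
  have ey : ∀ t, y (-t) = y t := fun t => by
    have := congrArg (fun p => p.2.2.1) (congrFun hrefl t); exact this.symm
  have ev : ∀ t, -v (-t) = v t := fun t => by
    have := congrArg (fun p => p.2.2.2) (congrFun hrefl t); exact this.symm
  -- bounds
  have un : ∀ t, 0 ≤ t → 0 ≤ u t := fun t ht => vel_nonneg hm.le ha ham hu u0 ht
  have vn : ∀ t, 0 ≤ t → 0 ≤ v t := fun t ht => vel_nonneg hm.le hb hbm hv v0 ht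
  have ul : ∀ t, 0 ≤ t → u t ≤ 2 := fun t ht => vel_le hm ha hu u0 vn ht
  have vl : ∀ t, 0 ≤ t → v t ≤ 2 := fun t ht => vel_le hm hb hv v0 un ht
  have xn : ∀ t, 0 ≤ x t := fun t => by
    rcases le_total 0 t with h | h
    · exact pos_nonneg hx x0 un h
    · rw [← ex]; exact pos_nonneg hx x0 un (by linarith)
  have yn : ∀ t, 0 ≤ y t := fun t => by
    rcases le_total 0 t with h | h
    · exact pos_nonneg hy y0 vn h
    · rw [← ey]; exact pos_nonneg hy y0 vn (by linarith)
  have cu : ∀ t, clampTwo (u t) = u t := fun t => by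
    rcases le_total 0 t with h | h
    · exact clampTwo_of_mem (by linarith [un t h]) (ul t h)
    · have h' : 0 ≤ -t := by linarith
      rw [← eu]
      exact clampTwo_of_mem (by linarith [ul _ h']) (by linarith [un _ h'])
  have cv : ∀ t, clampTwo (v t) = v t := fun t => by
    rcases le_total 0 t with h | h
    · exact clampTwo_of_mem (by linarith [vn t h]) (vl t h)
    · have h' : 0 ≤ -t := by linarith
      rw [← ev]
      exact clampTwo_of_mem (by linarith [vl _ h']) (by linarith [vn _ h'])
  refine ⟨x, u, y, v, x0, u0, y0, v0, fun t => cu t ▸ hx t, fun t => cv t ▸ hy t,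
    fun t => ?_, fun t => ?_, ex, ey⟩
  · have := hu t
    unfold accel at this
    rw [cu, cv, max_eq_left (xn t), ← neg_mul] at this
    exact this
  · have := hv t
    unfold accel at this
    rw [cu, cv, max_eq_left (yn t), ← neg_mul, mul_comm (v t) (u t)] at this
    exact this

theorem contDiff_two_aux {x u w : ℝ → ℝ} (hx : ∀ t, HasDerivAt x (u t) t)
    (hu : ∀ t, HasDerivAt u (w t) t) (hw : Continuous w) : ContDiff ℝ 2 x := by
  have dx : deriv x = u := funext fun t => (hx t).deriv
  have du : deriv u = w := funext fun t => (hu t).deriv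
  have h1 : ContDiff ℝ 1 u := by
    rw [contDiff_one_iff_deriv]
    exact ⟨fun t => (hu t).differentiableAt, du ▸ hw⟩
  rw [show (2 : WithTop ℕ∞) = 1 + 1 by norm_num, contDiff_succ_iff_deriv]
  exact ⟨fun t => (hx t).differentiableAt, by simp, dx ▸ h1⟩

/-- For `n ≥ 3` and `(n−1)/n ≤ s ≤ (n−1)/(n−2)` there is a global C² solution of `(S_s)`
on all of `ℝ` with zero initial data, and it is even in time. -/
theorem global_even_solution
    (n : ℕ) (hn : 3 ≤ n) (s : ℝ)
    (hs1 : ((n : ℝ) - 1) / (n : ℝ) ≤ s) (hs2 : s ≤ ((n : ℝ) - 1) / ((n : ℝ) - 2)) :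
    ∃ x y : ℝ → ℝ,
      ContDiff ℝ 2 x ∧ ContDiff ℝ 2 y ∧
      SysS n s x y Set.univ ∧ ZeroInit x y ∧
      (∀ t : ℝ, x (-t) = x t) ∧ (∀ t : ℝ, y (-t) = y t) := by
  have hn' : (3 : ℝ) ≤ n := by exact_mod_cast hn
  have hs : 0 < s := lt_of_lt_of_le (div_pos (by linarith) (by linarith)) hs1
  rw [div_le_iff₀ (by linarith)] at hs1
  rw [le_div_iff₀ (by linarith)] at hs2
  have a1 : 1 / s * ((n : ℝ) - 1) ≤ n := by
    rw [one_div_mul_eq_div, div_le_iff₀ hs]; linarith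
  have a2 : (n : ℝ) - 2 ≤ 1 / s * ((n : ℝ) - 1) := by
    rw [one_div_mul_eq_div, le_div_iff₀ hs]; linarith
  obtain ⟨x, u, y, v, x0, u0, y0, v0, hx, hy, hu, hv, ex, ey⟩ :=
    sys_aux n (1 / s * ((n : ℝ) - 1)) ((2 - 1 / s) * ((n : ℝ) - 1)) (by linarith) (by linarith) a1
      (by linarith) (by linarith)
  have dx : deriv x = u := funext fun t => (hx t).deriv
  have dy : deriv y = v := funext fun t => (hy t).deriv
  have cx : Continuous x := continuous_iff_continuousAt.2 fun t => (hx t).continuousAt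
  have cy : Continuous y := continuous_iff_continuousAt.2 fun t => (hy t).continuousAt
  have cu : Continuous u := continuous_iff_continuousAt.2 fun t => (hu t).continuousAt
  have cv : Continuous v := continuous_iff_continuousAt.2 fun t => (hv t).continuousAt
  refine ⟨x, y, contDiff_two_aux hx hu (by fun_prop), contDiff_two_aux hy hv (by fun_prop),
    ?_, ⟨x0, y0, by rw [dx, u0], by rw [dy, v0]⟩, ex, ey⟩
  intro t _
  rw [dx, dy]
  exact ⟨(hu t).deriv, (hv t).deriv⟩
end

section
/- Let n ≥ 2 be an integer and let s > 1/2 be a real number. Then there exists a pair of twice continuously differentiable functions x, y : [0,∞) → ℝ satisfying for all t ≥ 0 the system (N_s): x'' = n + (1/s)(n−1)e^{−2x} − (n/2)((x')² + x'·y') and y'' = n + (2 − 1/s)(n−1)e^{−2y} − (n/2)((y')² + x'·y'), with initial data x(0) = y(0) = 0 and x'(0) = y'(0) = √2. Moreover, x and y are strictly monotonically increasing on (0,∞), and the limit lim_{t→∞} (x(t) − y(t)) exists and is a finite real number. -/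
open Real Set Filter

/-- The ODE system (N_s):
`x'' = n + (1/s)(n−1)e^{−2x} − (n/2)((x')² + x'·y')` and
`y'' = n + (2 − 1/s)(n−1)e^{−2y} − (n/2)((y')² + x'·y')`, required at all points of `I`. -/
def SysN (n : ℕ) (s : ℝ) (x y : ℝ → ℝ) (I : Set ℝ) : Prop :=
  ∀ t ∈ I,
    deriv (deriv x) t =
      (n : ℝ) + (1 / s) * ((n : ℝ) - 1) * Real.exp (-2 * x t)
        - ((n : ℝ) / 2) * ((deriv x t) ^ 2 + deriv x t * deriv y t) ∧
    deriv (deriv y) t =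
      (n : ℝ) + (2 - 1 / s) * ((n : ℝ) - 1) * Real.exp (-2 * y t)
        - ((n : ℝ) / 2) * ((deriv y t) ^ 2 + deriv x t * deriv y t)

/-- Initial data `x(0) = y(0) = 0`, `x'(0) = y'(0) = √2` for the negative-curvature
product system. -/
def SqrtTwoInit (x y : ℝ → ℝ) : Prop :=
  x 0 = 0 ∧ y 0 = 0 ∧ deriv x 0 = Real.sqrt 2 ∧ deriv y 0 = Real.sqrt 2

/-- Bounded and globally Lipschitz real functions. -/
def BddLip {E : Type*} [PseudoMetricSpace E] (f : E → ℝ) : Prop :=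
  ∃ K C : ℝ, 0 ≤ K ∧ 0 ≤ C ∧ (∀ p q, |f p - f q| ≤ K * dist p q) ∧ ∀ p, |f p| ≤ C

lemma BddLip.const {E : Type*} [PseudoMetricSpace E] (c : ℝ) : BddLip (fun _ : E => c) :=
  ⟨0, |c|, le_rfl, abs_nonneg _, by simp, by simp⟩

lemma BddLip.add {E : Type*} [PseudoMetricSpace E] {f g : E → ℝ} (hf : BddLip f)
    (hg : BddLip g) : BddLip (fun p => f p + g p) := by
  obtain ⟨K, C, hK, hC, h1, h2⟩ := hf
  obtain ⟨K', C', hK', hC', h1', h2'⟩ := hg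
  refine ⟨K + K', C + C', by positivity, by positivity, fun p q => ?_, fun p => ?_⟩
  · have := abs_add_le (f p - f q) (g p - g q)
    rw [show f p + g p - (f q + g q) = (f p - f q) + (g p - g q) by ring]
    linarith [h1 p q, h1' p q]
  · linarith [abs_add_le (f p) (g p), h2 p, h2' p]

lemma BddLip.mul {E : Type*} [PseudoMetricSpace E] {f g : E → ℝ} (hf : BddLip f)
    (hg : BddLip g) : BddLip (fun p => f p * g p) := by
  obtain ⟨K, C, hK, hC, h1, h2⟩ := hf
  obtain ⟨K', C', hK', hC', h1', h2'⟩ := hg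
  refine ⟨C * K' + C' * K, C * C', by positivity, by positivity, fun p q => ?_, fun p => ?_⟩
  · have := abs_add_le (f p * (g p - g q)) (g q * (f p - f q))
    rw [show f p * g p - f q * g q = f p * (g p - g q) + g q * (f p - f q) by ring]
    rw [abs_mul, abs_mul] at this
    have a1 : |f p| * |g p - g q| ≤ C * (K' * dist p q) :=
      mul_le_mul (h2 p) (h1' p q) (abs_nonneg _) hC
    have a2 : |g q| * |f p - f q| ≤ C' * (K * dist p q) :=
      mul_le_mul (h2' q) (h1 p q) (abs_nonneg _) hC'
    linarith
  · rw [abs_mul]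
    exact mul_le_mul (h2 p) (h2' p) (abs_nonneg _) hC

lemma BddLip.comp {E : Type*} [PseudoMetricSpace E] {f : ℝ → ℝ} (hf : BddLip f)
    {g : E → ℝ} (hg : LipschitzWith 1 g) : BddLip (fun p => f (g p)) := by
  obtain ⟨K, C, hK, hC, h1, h2⟩ := hf
  refine ⟨K, C, hK, hC, fun p q => (h1 _ _).trans ?_, fun p => h2 _⟩
  have := hg.dist_le_mul p q
  simp only [NNReal.coe_one, one_mul] at this
  gcongr

/-- Truncation to `[1/2, 3]`. -/
noncomputable def clp (u : ℝ) : ℝ := max (1 / 2) (min u 3)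

/-- Truncated exponential. -/
noncomputable def texp (x : ℝ) : ℝ := Real.exp (-2 * max x 0)

lemma clp_ge (u : ℝ) : 1 / 2 ≤ clp u := le_max_left _ _

lemma clp_le (u : ℝ) : clp u ≤ 3 := max_le (by norm_num) (min_le_right _ _)

lemma clp_eq {u : ℝ} (h : 1 / 2 ≤ u) (h' : u ≤ 3) : clp u = u := by
  unfold clp
  rw [min_eq_left h', max_eq_right h]

lemma texp_pos (x : ℝ) : 0 < texp x := Real.exp_pos _

lemma texp_le (x : ℝ) : texp x ≤ 1 := by
  unfold texp
  rw [Real.exp_le_one_iff]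
  nlinarith [le_max_right x 0]

lemma texp_eq {x : ℝ} (h : 0 ≤ x) : texp x = Real.exp (-2 * x) := by
  unfold texp
  rw [max_eq_left h]

lemma bddLip_clp : BddLip clp := by
  have h : LipschitzWith 1 clp := (LipschitzWith.id.min_const 3).const_max (1 / 2)
  refine ⟨1, 3, by norm_num, by norm_num, fun p q => ?_, fun p => ?_⟩
  · simpa [Real.dist_eq] using h.dist_le_mul p q
  · rw [abs_le]
    constructor <;> linarith [clp_ge p, clp_le p]

lemma exp_lip_aux_s7 {a b : ℝ} (ha : 0 ≤ a) (hab : a ≤ b) :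
    |Real.exp (-2 * a) - Real.exp (-2 * b)| ≤ 2 * (b - a) := by
  have h1 : Real.exp (-2 * b) ≤ Real.exp (-2 * a) := Real.exp_le_exp.2 (by linarith)
  rw [abs_of_nonneg (by linarith)]
  have h2 : Real.exp (-2 * b) = Real.exp (-2 * a) * Real.exp (-2 * (b - a)) := by
    rw [← Real.exp_add]; ring_nf
  have h3 := Real.add_one_le_exp (-2 * (b - a))
  have h4 : Real.exp (-2 * a) ≤ 1 := by rw [Real.exp_le_one_iff]; linarith
  have h5 := Real.exp_pos (-2 * a)
  nlinarith

lemma bddLip_texp : BddLip texp := by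
  have h : LipschitzWith 1 (fun x : ℝ => max x 0) := LipschitzWith.id.max_const 0
  refine ⟨2, 1, by norm_num, by norm_num, fun p q => ?_, fun p => ?_⟩
  · have hd := h.dist_le_mul p q
    simp only [NNReal.coe_one, one_mul, Real.dist_eq] at hd ⊢
    unfold texp
    rcases le_total (max p 0) (max q 0) with hh | hh
    · have := exp_lip_aux_s7 (le_max_right p 0) hh
      rw [abs_of_nonpos (sub_nonpos.2 hh)] at hd
      linarith
    · have := exp_lip_aux_s7 (le_max_right q 0) hh
      rw [abs_sub_comm] at this
      rw [abs_of_nonneg (sub_nonneg.2 hh)] at hd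
      linarith
  · rw [abs_of_pos (texp_pos p)]
    exact texp_le p

/-- Global solutions for bounded, globally Lipschitz autonomous vector fields. -/
lemma exists_global {E : Type*} [NormedAddCommGroup E] [NormedSpace ℝ E] [CompleteSpace E]
    (F : E → E) (K L : NNReal) (hK : LipschitzWith K F) (hL : ∀ p, ‖F p‖ ≤ L) (p₀ : E) :
    ∃ γ : ℝ → E, γ 0 = p₀ ∧ ∀ t, HasDerivAt γ (F (γ t)) t := by
  have hloc : ∀ N : ℕ, ∃ α : ℝ → E, α 0 = p₀ ∧
      ∀ t ∈ Ioo (-((N : ℝ) + 1)) ((N : ℝ) + 1), HasDerivAt α (F (α t)) t := by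
    intro N
    have hmem : (0 : ℝ) ∈ Icc (-((N : ℝ) + 1)) ((N : ℝ) + 1) :=
      ⟨by linarith [Nat.cast_nonneg (α := ℝ) N], by positivity⟩
    have hPL : IsPicardLindelof (fun _ => F) (⟨0, hmem⟩ : Icc (-((N : ℝ) + 1)) ((N : ℝ) + 1))
        p₀ (L * ((N : NNReal) + 1)) 0 L K := by
      apply IsPicardLindelof.of_time_independent (fun x _ => hL x) hK.lipschitzOnWith
      simp
    obtain ⟨α, h0, h1⟩ := hPL.exists_eq_forall_mem_Icc_hasDerivWithinAt₀
    exact ⟨α, h0, fun t ht => (h1 t (Ioo_subset_Icc_self ht)).hasDerivAt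
      (Icc_mem_nhds ht.1 ht.2)⟩
  choose α h0 h1 using hloc
  have huniq : ∀ N M : ℕ, N ≤ M →
      EqOn (α N) (α M) (Ioo (-((N : ℝ) + 1)) ((N : ℝ) + 1)) := by
    intro N M hNM
    have hc : (N : ℝ) ≤ M := by exact_mod_cast hNM
    refine ODE_solution_unique_of_mem_Ioo (v := fun _ => F) (s := fun _ => univ) (K := K)
      (t₀ := 0) (fun _ _ => hK.lipschitzOnWith) ⟨?_, ?_⟩ (fun t ht => ⟨h1 N t ht, trivial⟩)
      (fun t ht => ⟨h1 M t ⟨?_, ?_⟩, trivial⟩) ((h0 N).trans (h0 M).symm)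
    · linarith [Nat.cast_nonneg (α := ℝ) N]
    · positivity
    · linarith [ht.1]
    · linarith [ht.2]
  have hmem : ∀ t : ℝ, t ∈ Ioo (-((⌈|t|⌉₊ : ℝ) + 1)) ((⌈|t|⌉₊ : ℝ) + 1) := by
    intro t
    have := Nat.le_ceil |t|
    constructor
    · linarith [neg_abs_le t]
    · linarith [le_abs_self t]
  refine ⟨fun t => α ⌈|t|⌉₊ t, h0 _, fun t => ?_⟩
  set N := ⌈|t|⌉₊ with hN
  have hev : (fun t => α ⌈|t|⌉₊ t) =ᶠ[nhds t] α N := by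
    filter_upwards [Ioo_mem_nhds (hmem t).1 (hmem t).2] with r hr
    rcases le_total ⌈|r|⌉₊ N with h | h
    · exact huniq _ _ h (hmem r)
    · exact (huniq _ _ h hr).symm
  exact (h1 N t (hmem t)).congr_of_eventuallyEq hev

/-- Barrier principle on `[0, ∞)`. -/
lemma barrier {f f' B B' : ℝ → ℝ} (hf : ∀ t, HasDerivAt f (f' t) t)
    (hB : ∀ t, HasDerivAt B (B' t) t) (h0 : f 0 ≤ B 0)
    (hb : ∀ t, 0 ≤ t → f t = B t → f' t < B' t) : ∀ t, 0 ≤ t → f t ≤ B t := by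
  intro t ht
  exact image_le_of_deriv_right_lt_deriv_boundary (a := 0) (b := t)
    (fun x _ => (hf x).continuousAt.continuousWithinAt)
    (fun x _ => (hf x).hasDerivWithinAt) h0 hB (fun x hx => hb x hx.1) ⟨ht, le_rfl⟩

lemma sqrt_two_bds : 1 / 2 ≤ Real.sqrt 2 ∧ Real.sqrt 2 ≤ 3 := by
  constructor
  · apply Real.le_sqrt_of_sq_le; norm_num
  · rw [Real.sqrt_le_left (by norm_num)]; norm_num

/-- Right-hand side of the truncated equation. -/
noncomputable def rhs (n c x u v : ℝ) : ℝ :=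
  n + c * (n - 1) * texp x - n / 2 * (clp u ^ 2 + clp u * clp v)

lemma u_bounds {n c : ℝ} (hn : 2 ≤ n) (hc : 0 < c) (hc2 : c < 2) {X u v : ℝ → ℝ}
    (hu : ∀ t, HasDerivAt u (rhs n c (X t) (u t) (v t)) t) (h0 : u 0 = Real.sqrt 2) :
    ∀ t, 0 ≤ t → 1 / 2 ≤ u t ∧ u t ≤ 3 := by
  intro t ht
  constructor
  · refine barrier (f := fun _ => 1 / 2) (f' := fun _ => 0) (fun t => hasDerivAt_const _ _) hu
      (by rw [h0]; exact sqrt_two_bds.1) (fun r _ hr => ?_) t ht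
    have hcl : clp (u r) = 1 / 2 := by
      rw [← hr]; exact clp_eq le_rfl (by norm_num)
    have h1 : 0 ≤ c * (n - 1) * texp (X r) :=
      mul_nonneg (mul_nonneg hc.le (by linarith)) (texp_pos _).le
    have h2 := clp_le (v r)
    unfold rhs
    rw [hcl]
    nlinarith
  · refine barrier (B := fun _ => 3) (B' := fun _ => 0) hu (fun t => hasDerivAt_const _ _)
      (by rw [h0]; exact sqrt_two_bds.2) (fun r _ hr => ?_) t ht
    have hcl : clp (u r) = 3 := by
      rw [hr]; exact clp_eq (by norm_num) le_rfl
    have h1 : c * (n - 1) * texp (X r) ≤ 2 * (n - 1) * 1 :=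
      mul_le_mul (mul_le_mul_of_nonneg_right hc2.le (by linarith)) (texp_le _)
        (texp_pos _).le (by linarith)
    have h2 := clp_ge (v r)
    unfold rhs
    rw [hcl]
    nlinarith

lemma rhs_bddLip (n c : ℝ) {E : Type*} [PseudoMetricSpace E] {f g h : E → ℝ}
    (hf : LipschitzWith 1 f) (hg : LipschitzWith 1 g) (hh : LipschitzWith 1 h) :
    BddLip (fun p => rhs n c (f p) (g p) (h p)) := by
  have U := bddLip_clp.comp hg
  have V := bddLip_clp.comp hh
  have T := bddLip_texp.comp hf
  have := ((BddLip.const n).add ((BddLip.const (c * (n - 1))).mul T)).add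
    ((BddLip.const (-(n / 2))).mul ((U.mul U).add (U.mul V)))
  convert this using 2 with p
  unfold rhs
  ring

lemma BddLip.lip {E : Type*} [PseudoMetricSpace E] {f : E → ℝ} (hf : BddLip f) :
    ∃ K L : NNReal, LipschitzWith K f ∧ ∀ p, ‖f p‖ ≤ L := by
  obtain ⟨K, C, hK, hC, h1, h2⟩ := hf
  refine ⟨⟨K, hK⟩, ⟨C, hC⟩, LipschitzWith.of_dist_le_mul fun p q => ?_, h2⟩
  rw [Real.dist_eq]
  exact h1 p q

lemma exists_truncated (n a b : ℝ) : ∃ x y u v : ℝ → ℝ,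
    x 0 = 0 ∧ y 0 = 0 ∧ u 0 = Real.sqrt 2 ∧ v 0 = Real.sqrt 2 ∧
    (∀ t, HasDerivAt x (clp (u t)) t) ∧ (∀ t, HasDerivAt y (clp (v t)) t) ∧
    (∀ t, HasDerivAt u (rhs n a (x t) (u t) (v t)) t) ∧
    (∀ t, HasDerivAt v (rhs n b (y t) (v t) (u t)) t) := by
  have l1 : LipschitzWith 1 (fun p : ℝ × ℝ × ℝ × ℝ => p.1) := LipschitzWith.prod_fst
  have l2 : LipschitzWith 1 (fun p : ℝ × ℝ × ℝ × ℝ => p.2.1) := by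
    simpa using! LipschitzWith.prod_fst.comp LipschitzWith.prod_snd
  have l3 : LipschitzWith 1 (fun p : ℝ × ℝ × ℝ × ℝ => p.2.2.1) := by
    simpa using! LipschitzWith.prod_fst.comp (LipschitzWith.prod_snd.comp LipschitzWith.prod_snd)
  have l4 : LipschitzWith 1 (fun p : ℝ × ℝ × ℝ × ℝ => p.2.2.2) := by
    simpa using! LipschitzWith.prod_snd.comp (LipschitzWith.prod_snd.comp LipschitzWith.prod_snd)
  obtain ⟨K1, L1, k1, b1⟩ := (bddLip_clp.comp l3).lip
  obtain ⟨K2, L2, k2, b2⟩ := (bddLip_clp.comp l4).lip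
  obtain ⟨K3, L3, k3, b3⟩ := (rhs_bddLip n a l1 l3 l4).lip
  obtain ⟨K4, L4, k4, b4⟩ := (rhs_bddLip n b l2 l4 l3).lip
  obtain ⟨γ, g0, hg⟩ := exists_global
    (fun p : ℝ × ℝ × ℝ × ℝ => (clp p.2.2.1, clp p.2.2.2, rhs n a p.1 p.2.2.1 p.2.2.2,
      rhs n b p.2.1 p.2.2.2 p.2.2.1)) _ (max L1 (max L2 (max L3 L4)))
    (k1.prodMk (k2.prodMk (k3.prodMk k4)))
    (by
      intro p
      simp only [Prod.norm_mk, NNReal.coe_max]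
      exact max_le_max (b1 p) (max_le_max (b2 p) (max_le_max (b3 p) (b4 p))))
    (0, 0, Real.sqrt 2, Real.sqrt 2)
  refine ⟨fun t => (γ t).1, fun t => (γ t).2.1, fun t => (γ t).2.2.1, fun t => (γ t).2.2.2,
    by simp [g0], by simp [g0], by simp [g0], by simp [g0], fun t => ?_, fun t => ?_,
    fun t => ?_, fun t => ?_⟩
  · exact (hg t).fst
  · exact (hg t).snd.fst
  · exact (hg t).snd.snd.fst
  · exact (hg t).snd.snd.snd

lemma continuous_clp : Continuous clp := by unfold clp; fun_prop

lemma continuous_texp : Continuous texp := by unfold texp; fun_prop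

lemma x_lower {x u : ℝ → ℝ} (h0 : x 0 = 0) (hx : ∀ t, HasDerivAt x (clp (u t)) t) :
    ∀ t, 0 ≤ t → t / 2 ≤ x t := by
  have hd : ∀ t, HasDerivAt (fun t => x t - t / 2) (clp (u t) - 1 / 2) t := fun t =>
    (hx t).sub ((hasDerivAt_id t).div_const 2)
  have hm : Monotone (fun t => x t - t / 2) :=
    monotone_of_deriv_nonneg (fun t => (hd t).differentiableAt) (fun t => by
      rw [(hd t).deriv]; linarith [clp_ge (u t)])
  intro t ht
  have := hm ht
  simp only [h0] at this
  linarith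

lemma x_strictMono {x u : ℝ → ℝ} (hx : ∀ t, HasDerivAt x (clp (u t)) t) : StrictMono x :=
  strictMono_of_deriv_pos fun t => by rw [(hx t).deriv]; linarith [clp_ge (u t)]

lemma x_contDiff {n c : ℝ} {x u v : ℝ → ℝ} (hx : ∀ t, HasDerivAt x (clp (u t)) t)
    (hu : ∀ t, HasDerivAt u (rhs n c (x t) (u t) (v t)) t) (hv : Continuous v)
    (hb : ∀ t, 0 ≤ t → 1 / 2 ≤ u t ∧ u t ≤ 3) : ContDiffOn ℝ 2 x (Ici 0) := by
  have xc : Continuous x := continuous_iff_continuousAt.2 fun t => (hx t).continuousAt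
  have uc : Continuous u := continuous_iff_continuousAt.2 fun t => (hu t).continuousAt
  have u1 : ContDiff ℝ 1 u := by
    rw [contDiff_one_iff_deriv]
    refine ⟨fun t => (hu t).differentiableAt, ?_⟩
    rw [show deriv u = fun t => rhs n c (x t) (u t) (v t) from funext fun t => (hu t).deriv]
    unfold rhs
    have c1 := continuous_texp.comp xc
    have c2 := continuous_clp.comp uc
    have c3 := continuous_clp.comp hv
    simp only [Function.comp_def] at c1 c2 c3
    fun_prop
  rw [show (2 : WithTop ℕ∞) = 1 + 1 by norm_num,
    contDiffOn_succ_iff_derivWithin (uniqueDiffOn_Ici 0)]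
  refine ⟨fun t _ => (hx t).differentiableAt.differentiableWithinAt, by simp, ?_⟩
  refine u1.contDiffOn.congr fun t ht => ?_
  rw [(hx t).hasDerivWithinAt.derivWithin (uniqueDiffOn_Ici 0 t ht)]
  exact clp_eq (hb t ht).1 (hb t ht).2

lemma deriv2_eq {n c : ℝ} {x u v : ℝ → ℝ} (h0 : u 0 = Real.sqrt 2)
    (hx : ∀ t, HasDerivAt x (clp (u t)) t)
    (hu : ∀ t, HasDerivAt u (rhs n c (x t) (u t) (v t)) t)
    (hb : ∀ t, 0 ≤ t → 1 / 2 ≤ u t ∧ u t ≤ 3) (t : ℝ) (ht : 0 ≤ t) :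
    deriv (deriv x) t = rhs n c (x t) (u t) (v t) := by
  have hev : deriv x =ᶠ[nhds t] u := by
    rcases ht.eq_or_lt with rfl | ht
    · have h1 : 1 / 2 < u 0 := by
        rw [h0]; apply Real.lt_sqrt_of_sq_lt; norm_num
      have h2 : u 0 < 3 := by
        rw [h0, Real.sqrt_lt' (by norm_num)]; norm_num
      filter_upwards [(hu 0).continuousAt.eventually (Ioo_mem_nhds h1 h2)] with r hr
      rw [(hx r).deriv]
      exact clp_eq hr.1.le hr.2.le
    · filter_upwards [Ioi_mem_nhds ht] with r hr
      rw [(hx r).deriv]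
      exact clp_eq (hb r (le_of_lt hr)).1 (hb r (le_of_lt hr)).2
  rw [hev.deriv_eq, (hu t).deriv]

lemma w_upper {n a b : ℝ} (hn : 2 ≤ n) (ha : 0 < a) (ha2 : a < 2) (hb : 0 < b)
    {x y u v : ℝ → ℝ} (hxl : ∀ t, 0 ≤ t → t / 2 ≤ x t)
    (hu : ∀ t, HasDerivAt u (rhs n a (x t) (u t) (v t)) t)
    (hv : ∀ t, HasDerivAt v (rhs n b (y t) (v t) (u t)) t)
    (hub : ∀ t, 0 ≤ t → 1 / 2 ≤ u t ∧ u t ≤ 3) (hvb : ∀ t, 0 ≤ t → 1 / 2 ≤ v t ∧ v t ≤ 3)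
    (h0 : u 0 = v 0) : ∀ t, 0 ≤ t → u t - v t ≤ 5 * Real.exp (-(1 / 2) * t) := by
  have hB : ∀ t : ℝ, HasDerivAt (fun t : ℝ => 5 * Real.exp (-(1 / 2) * t))
      (5 * (Real.exp (-(1 / 2) * t) * (-(1 / 2) * 1))) t := fun t =>
    (((hasDerivAt_id t).const_mul (-(1 / 2))).exp).const_mul 5
  refine barrier (f := fun t => u t - v t) (fun t => (hu t).sub (hv t)) hB (by simp [h0]) ?_
  intro t ht heq
  unfold rhs
  rw [clp_eq (hub t ht).1 (hub t ht).2, clp_eq (hvb t ht).1 (hvb t ht).2]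
  have hE : 0 < Real.exp (-(1 / 2) * t) := Real.exp_pos _
  have h1 : texp (x t) ≤ Real.exp (-(1 / 2) * t) := by
    rw [texp_eq (by linarith [hxl t ht])]
    exact Real.exp_le_exp.2 (by linarith [hxl t ht])
  have h2 : a * (n - 1) * texp (x t) ≤ 2 * (n - 1) * Real.exp (-(1 / 2) * t) :=
    mul_le_mul (mul_le_mul_of_nonneg_right ha2.le (by linarith)) h1
        (texp_pos _).le (by linarith)
  have h3 : 0 ≤ b * (n - 1) * texp (y t) :=
      mul_nonneg (mul_nonneg hb.le (by linarith)) (texp_pos _).le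
  have h4 : n / 2 * 1 * (5 * Real.exp (-(1 / 2) * t)) ≤
      n / 2 * (u t + v t) * (u t - v t) := by
    rw [heq]
    have : 1 ≤ u t + v t := by linarith [(hub t ht).1, (hvb t ht).1]
    gcongr
  nlinarith

/-- For `n ≥ 2` and `s > 1/2` the system `(N_s)` with data `x(0)=y(0)=0`,
`x'(0)=y'(0)=√2` has a global solution on `[0,∞)`; moreover `x`, `y` are strictly
increasing on `(0,∞)` and `lim_{t→∞}(x(t) − y(t))` exists and is finite. -/
theorem global_solution_negative_products
    (n : ℕ) (hn : 2 ≤ n) (s : ℝ) (hs : 1 / 2 < s) :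
    ∃ x y : ℝ → ℝ,
      ContDiffOn ℝ 2 x (Ici (0 : ℝ)) ∧ ContDiffOn ℝ 2 y (Ici (0 : ℝ)) ∧
      SysN n s x y (Ici (0 : ℝ)) ∧ SqrtTwoInit x y ∧
      StrictMonoOn x (Ioi (0 : ℝ)) ∧ StrictMonoOn y (Ioi (0 : ℝ)) ∧
      ∃ L : ℝ, Filter.Tendsto (fun t => x t - y t) Filter.atTop (nhds L) := by
  obtain ⟨x, y, u, v, x0, y0, u0, v0, hx, hy, hu, hv⟩ := exists_truncated n (1 / s) (2 - 1 / s)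
  have hn' : (2 : ℝ) ≤ n := by exact_mod_cast hn
  have hs0 : 0 < s := by linarith
  have ha : 0 < 1 / s := by positivity
  have ha2 : 1 / s < 2 := by rw [div_lt_iff₀ hs0]; linarith
  have hb : 0 < 2 - 1 / s := by linarith
  have hb2 : 2 - 1 / s < 2 := by linarith
  have hub := u_bounds hn' ha ha2 hu u0
  have hvb := u_bounds hn' hb hb2 hv v0
  have uc : Continuous u := continuous_iff_continuousAt.2 fun t => (hu t).continuousAt
  have vc : Continuous v := continuous_iff_continuousAt.2 fun t => (hv t).continuousAt
  have hxl := x_lower x0 hx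
  have hyl := x_lower y0 hy
  have dx : ∀ t, 0 ≤ t → deriv x t = u t := fun t ht => by
    rw [(hx t).deriv, clp_eq (hub t ht).1 (hub t ht).2]
  have dy : ∀ t, 0 ≤ t → deriv y t = v t := fun t ht => by
    rw [(hy t).deriv, clp_eq (hvb t ht).1 (hvb t ht).2]
  refine ⟨x, y, x_contDiff hx hu vc hub, x_contDiff hy hv uc hvb, ?_, ?_,
    (x_strictMono hx).strictMonoOn _, (x_strictMono hy).strictMonoOn _, ?_⟩
  · intro t ht
    have ht' : 0 ≤ t := ht
    rw [deriv2_eq u0 hx hu hub t ht', deriv2_eq v0 hy hv hvb t ht', dx t ht', dy t ht']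
    unfold rhs
    rw [clp_eq (hub t ht').1 (hub t ht').2, clp_eq (hvb t ht').1 (hvb t ht').2,
      texp_eq (by linarith [hxl t ht']), texp_eq (by linarith [hyl t ht'])]
    exact ⟨rfl, by ring⟩
  · exact ⟨x0, y0, by rw [dx 0 le_rfl, u0], by rw [dy 0 le_rfl, v0]⟩
  · have w1 := w_upper hn' ha ha2 hb hxl hu hv hub hvb (u0.trans v0.symm)
    have w2 := w_upper hn' hb hb2 ha hyl hv hu hvb hub (v0.trans u0.symm)
    refine ⟨_, MeasureTheory.tendsto_limUnder_of_hasDerivAt_of_integrableOn_Ioi (a := 0)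
      (f' := fun t => u t - v t) (fun t ht => ?_) ?_⟩
    · have ht' : 0 ≤ t := le_of_lt ht
      have := (hx t).sub (hy t)
      rw [clp_eq (hub t ht').1 (hub t ht').2, clp_eq (hvb t ht').1 (hvb t ht').2] at this
      exact this
    · have hi := (exp_neg_integrableOn_Ioi 0 (b := 1 / 2) (by norm_num)).const_mul 5
      refine MeasureTheory.Integrable.mono' hi (uc.sub vc).aestronglyMeasurable ?_
      filter_upwards [MeasureTheory.ae_restrict_mem measurableSet_Ioi] with t ht
      have ht' : 0 ≤ t := le_of_lt ht
      rw [Real.norm_eq_abs, abs_le]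
      constructor <;> linarith [w1 t ht', w2 t ht']
end

section
/- Let n ≥ 2 be an integer, let s > 1/2 be a real number, let I be an interval containing 0, and let x, y : I → ℝ be twice continuously differentiable functions satisfying on I the system (N_s): x'' = n + (1/s)(n−1)e^{−2x} − (n/2)((x')² + x'·y') and y'' = n + (2 − 1/s)(n−1)e^{−2y} − (n/2)((y')² + x'·y'), with initial data x(0) = y(0) = 0 and x'(0) = y'(0) = √2. Then the conservation law x''(t) + y''(t) + (x'(t))² + (y'(t))² = 2 holds for all t ∈ I. -/
open Real Set Filter

/-- If a nonzero second derivative is forced wherever `deriv f` vanishes, then `deriv f` is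
continuous on the interval `I`, endpoints included. -/
theorem contOn_deriv_aux (I : Set ℝ) (hc : Convex ℝ I) (hne : (interior I).Nonempty)
    (f : ℝ → ℝ) (hf : ContDiffOn ℝ 2 f I)
    (h : ∀ t ∈ I, deriv f t = 0 → deriv (deriv f) t ≠ 0) :
    ContinuousOn (deriv f) I := by
  have hu : UniqueDiffOn ℝ I := uniqueDiffOn_convex hc hne
  have hcont : ContinuousOn (derivWithin f I) I :=
    hf.continuousOn_derivWithin hu (by norm_num)
  refine hcont.congr ?_
  intro t ht
  by_cases hd : DifferentiableAt ℝ f t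
  · exact (hd.derivWithin (hu t ht)).symm
  · have h1 : deriv f t = 0 := deriv_zero_of_not_differentiableAt hd
    have h2 : DifferentiableAt ℝ (deriv f) t := by
      by_contra h3
      exact h t ht h1 (deriv_zero_of_not_differentiableAt h3)
    have hcl : t ∈ closure (interior I) := by
      rw [hc.closure_interior_eq_closure_of_nonempty_interior hne]
      exact subset_closure ht
    haveI : (nhdsWithin t (interior I)).NeBot := mem_closure_iff_nhdsWithin_neBot.1 hcl
    have l1 : Tendsto (deriv f) (nhdsWithin t (interior I)) (nhds (deriv f t)) :=
      h2.continuousAt.tendsto.mono_left nhdsWithin_le_nhds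
    have l2 : Tendsto (derivWithin f I) (nhdsWithin t (interior I))
        (nhds (derivWithin f I t)) :=
      (hcont t ht).mono_left (nhdsWithin_mono _ interior_subset)
    refine tendsto_nhds_unique l1 (l2.congr' ?_)
    filter_upwards [self_mem_nhdsWithin] with u hu'
    exact derivWithin_of_mem_nhds (mem_interior_iff_mem_nhds.1 hu')

/-- Interior regularity. -/
theorem interior_aux (I : Set ℝ) (f : ℝ → ℝ) (hf : ContDiffOn ℝ 2 f I)
    (t : ℝ) (ht : t ∈ interior I) :
    HasDerivAt f (deriv f t) t ∧ HasDerivAt (deriv f) (deriv (deriv f) t) t := by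
  have h := hf.contDiffAt (mem_interior_iff_mem_nhds.1 ht)
  refine ⟨(h.differentiableAt (by norm_num)).hasDerivAt, ?_⟩
  have h2 : ContDiffOn ℝ 1 (deriv f) (interior I) :=
    (hf.mono interior_subset).deriv_of_isOpen isOpen_interior (by norm_num)
  exact ((h2.contDiffAt (isOpen_interior.mem_nhds ht)).differentiableAt
    (by norm_num)).hasDerivAt

/-- Conservation law for `(N_s)` with initial data `x(0)=y(0)=0`, `x'(0)=y'(0)=√2`:
on any interval `I ∋ 0`, `x'' + y'' + (x')² + (y')² = 2`. -/
theorem conservation_law_SysN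
    (n : ℕ) (hn : 2 ≤ n) (s : ℝ) (hs : 1 / 2 < s)
    (I : Set ℝ) (hI : I.OrdConnected) (h0 : (0 : ℝ) ∈ I)
    (x y : ℝ → ℝ)
    (hx : ContDiffOn ℝ 2 x I) (hy : ContDiffOn ℝ 2 y I)
    (hsys : SysN n s x y I) (hinit : SqrtTwoInit x y) :
    ∀ t ∈ I,
      deriv (deriv x) t + deriv (deriv y) t + (deriv x t) ^ 2 + (deriv y t) ^ 2 = 2 := by
  obtain ⟨hx0, hy0, hp0, hq0⟩ := hinit
  have hn' : (2 : ℝ) ≤ n := by exact_mod_cast hn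
  have hs0 : 0 < s := by linarith
  have ha : 0 < 1 / s := by positivity
  have hb : 0 < 2 - 1 / s := by
    have : 1 / s < 2 := by rw [div_lt_iff₀ hs0]; linarith
    linarith
  have hsq : Real.sqrt 2 ^ 2 = 2 := Real.sq_sqrt (by norm_num)
  have at0 : deriv (deriv x) 0 + deriv (deriv y) 0 + (deriv x 0) ^ 2 + (deriv y 0) ^ 2 = 2 := by
    obtain ⟨e1, e2⟩ := hsys 0 h0
    rw [e1, e2, hx0, hy0, hp0, hq0]
    simp only [mul_zero, Real.exp_zero]
    linear_combination (2 - 2 * (n : ℝ)) * hsq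
  intro t ht
  by_cases ht0 : t = 0
  · rw [ht0]; exact at0
  have hc : Convex ℝ I := hI.convex
  have hne : (interior I).Nonempty := by
    have : ∀ a ∈ I, ∀ b ∈ I, a < b → (interior I).Nonempty := by
      intro a ha b hb hab
      refine ⟨(a + b) / 2, ?_⟩
      have : Ioo a b ⊆ interior I :=
        interior_maximal (Ioo_subset_Icc_self.trans (hI.out ha hb)) isOpen_Ioo
      exact this ⟨by linarith, by linarith⟩
    rcases lt_or_gt_of_ne ht0 with h | h
    · exact this _ ht _ h0 h
    · exact this _ h0 _ ht h
  have cp : ContinuousOn (deriv x) I := by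
    refine contOn_deriv_aux I hc hne x hx ?_
    intro u hu h
    rw [(hsys u hu).1, h]
    have : 0 < (1 / s) * ((n : ℝ) - 1) * Real.exp (-2 * x u) :=
      mul_pos (mul_pos ha (by linarith)) (Real.exp_pos _)
    apply ne_of_gt
    ring_nf at this ⊢
    linarith
  have cq : ContinuousOn (deriv y) I := by
    refine contOn_deriv_aux I hc hne y hy ?_
    intro u hu h
    rw [(hsys u hu).2, h]
    have : 0 < (2 - 1 / s) * ((n : ℝ) - 1) * Real.exp (-2 * y u) :=
      mul_pos (mul_pos hb (by linarith)) (Real.exp_pos _)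
    apply ne_of_gt
    ring_nf at this ⊢
    linarith
  have cx := hx.continuousOn
  have cy := hy.continuousOn
  set a : ℝ := (1 / s) * ((n : ℝ) - 1) with ha_def
  set b : ℝ := (2 - 1 / s) * ((n : ℝ) - 1) with hb_def
  let F : ℝ → ℝ := fun u => 2 * (n : ℝ) + a * Real.exp (-2 * x u) + b * Real.exp (-2 * y u)
    - ((n : ℝ) / 2) * (deriv x u + deriv y u) ^ 2 + (deriv x u) ^ 2 + (deriv y u) ^ 2 - 2
  let G : ℝ → ℝ := fun u => F u * Real.exp ((n : ℝ) * (x u + y u))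
  have hF : ∀ u ∈ I, F u =
      deriv (deriv x) u + deriv (deriv y) u + (deriv x u) ^ 2 + (deriv y u) ^ 2 - 2 := by
    intro u hu
    rw [(hsys u hu).1, (hsys u hu).2]
    simp only [F]
    ring
  have cG : ContinuousOn G I := by
    simp only [G, F]
    fun_prop
  have dG : ∀ u ∈ interior I, HasDerivAt G 0 u := by
    intro u hu
    obtain ⟨dx, dp⟩ := interior_aux I x hx u hu
    obtain ⟨dy, dq⟩ := interior_aux I y hy u hu
    obtain ⟨e1, e2⟩ := hsys u (interior_subset hu)
    have dF := ((((((((dx.const_mul (-2)).exp.const_mul a).const_add (2 * (n : ℝ))).add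
      ((dy.const_mul (-2)).exp.const_mul b)).sub
      (((dp.add dq).pow 2).const_mul ((n : ℝ) / 2))).add (dp.pow 2)).add (dq.pow 2)).sub_const 2)
    have dE := ((dx.add dy).const_mul (n : ℝ)).exp
    refine (dF.mul dE).congr_deriv ?_
    rw [e1, e2]
    simp only [Pi.add_apply, Pi.sub_apply, Pi.pow_apply]
    push_cast
    ring
  have hm : MonotoneOn G I := monotoneOn_of_deriv_nonneg hc cG
    (fun u hu => (dG u hu).differentiableAt.differentiableWithinAt)
    (fun u hu => (dG u hu).deriv.ge)
  have hm' : AntitoneOn G I := antitoneOn_of_deriv_nonpos hc cG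
    (fun u hu => (dG u hu).differentiableAt.differentiableWithinAt)
    (fun u hu => (dG u hu).deriv.le)
  have hG : G t = G 0 := by
    rcases le_total t 0 with h | h
    · exact le_antisymm (hm ht h0 h) (hm' ht h0 h)
    · exact le_antisymm (hm' h0 ht h) (hm h0 ht h)
  have hG0 : G 0 = 0 := by
    have : F 0 = 0 := by rw [hF 0 h0]; linarith
    simp only [G, this, zero_mul]
  have hFt : F t = 0 := by
    have : F t * Real.exp ((n : ℝ) * (x t + y t)) = 0 := hG.trans hG0
    exact (mul_eq_zero.1 this).resolve_right (Real.exp_pos _).ne'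
  rw [hF t ht] at hFt
  linarith
end

section
/- Let n ≥ 3 be an integer and let s > (n−1)/(n−2). Let T ∈ (0,∞] and let x, y : [0,T) → ℝ be twice continuously differentiable functions satisfying the system (S_s) with zero initial data. Then x is strictly monotonically increasing and y is strictly monotonically decreasing on [0,T); in particular x'(t) > 0 and y'(t) < 0 for all t ∈ (0,T). -/
open Real Set Filter

open scoped Topology in
lemma pair_pos (f g : ℝ → ℝ) (b : ℝ)
    (hfc : ContinuousOn f (Ioc 0 b)) (hgc : ContinuousOn g (Ioc 0 b))
    (hf0 : f 0 = 0) (hg0 : g 0 = 0) (hdf : 0 < deriv f 0) (hdg : 0 < deriv g 0)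
    (H : ∀ t ∈ Ioc 0 b, (∀ u ∈ Ioo 0 t, 0 < f u ∧ 0 < g u) →
      (f t = 0 → 0 < deriv f t) ∧ (g t = 0 → 0 < deriv g t)) :
    ∀ t ∈ Ioc 0 b, 0 < f t ∧ 0 < g t := by
  by_contra hcon
  push Not at hcon
  obtain ⟨t₁, ht₁, hbad⟩ := hcon
  have ev : ∀ᶠ t in 𝓝 (0:ℝ), 0 < t → 0 < f t ∧ 0 < g t := by
    filter_upwards [eventually_nhdsWithin_sign_eq_of_deriv_pos hdf hf0,
      eventually_nhdsWithin_sign_eq_of_deriv_pos hdg hg0] with t h1 h2 ht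
    rw [sub_zero, sign_pos ht] at h1 h2
    exact ⟨sign_eq_one_iff.1 h1, sign_eq_one_iff.1 h2⟩
  obtain ⟨ε, hε, hball⟩ := Metric.eventually_nhds_iff.1 ev
  have hsmall : ∀ t, 0 < t → t < ε → 0 < f t ∧ 0 < g t := by
    intro t h0 h1
    exact hball (by rw [Real.dist_eq, sub_zero, abs_of_pos h0]; exact h1) h0
  have hsub : Icc (ε / 2) t₁ ⊆ Ioc 0 b := fun t ht =>
    ⟨by linarith [ht.1], ht.2.trans ht₁.2⟩
  have hmin : ContinuousOn (fun t => min (f t) (g t)) (Icc (ε / 2) t₁) :=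
    (hfc.mono hsub).inf (hgc.mono hsub)
  have hbad' : min (f t₁) (g t₁) ≤ 0 := by
    by_cases h : 0 < f t₁
    · exact (min_le_right _ _).trans (hbad h)
    · exact (min_le_left _ _).trans (not_lt.1 h)
  have hεt : ε / 2 ≤ t₁ := by
    by_contra h
    have := hsmall t₁ ht₁.1 (by linarith)
    exact absurd (lt_min this.1 this.2) (not_lt.2 hbad')
  have hcl : IsClosed (Icc (ε / 2) t₁ ∩ (fun t => min (f t) (g t)) ⁻¹' Iic 0) :=
    hmin.preimage_isClosed_of_isClosed isClosed_Icc isClosed_Iic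
  have hcomp : IsCompact (Icc (ε / 2) t₁ ∩ (fun t => min (f t) (g t)) ⁻¹' Iic 0) :=
    isCompact_Icc.of_isClosed_subset hcl inter_subset_left
  obtain ⟨t₀, ⟨ht₀, hle⟩, hleast⟩ := hcomp.exists_isLeast ⟨t₁, ⟨⟨hεt, le_rfl⟩, hbad'⟩⟩
  have ht₀' := hsub ht₀
  have hbefore : ∀ u ∈ Ioo 0 t₀, 0 < f u ∧ 0 < g u := by
    intro u hu
    by_cases h : u < ε
    · exact hsmall u hu.1 h
    · by_contra hn
      have : t₀ ≤ u := hleast ⟨⟨by linarith, hu.2.le.trans ht₀.2⟩, by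
        rw [← lt_min_iff, not_lt] at hn; exact hn⟩
      linarith [hu.2]
  have key : ∀ h : ℝ → ℝ, ContinuousOn h (Ioc 0 b) → (∀ u ∈ Ioo 0 t₀, 0 < h u) →
      (h t₀ = 0 → 0 < deriv h t₀) → 0 < h t₀ := by
    intro h hc hp hd
    have hmem : Ioo 0 t₀ ∈ 𝓝[<] t₀ := Ioo_mem_nhdsLT ht₀'.1
    have hge : 0 ≤ h t₀ := by
      have ht : Tendsto h (𝓝[<] t₀) (𝓝 (h t₀)) :=
        (hc t₀ ht₀').mono_left (nhdsWithin_le_iff.2 (mem_of_superset hmem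
          fun u hu => ⟨hu.1, hu.2.le.trans ht₀'.2⟩))
      exact ge_of_tendsto ht (mem_of_superset hmem fun u hu => (hp u hu).le)
    rcases hge.lt_or_eq with h1 | h1
    · exact h1
    · exfalso
      have e := eventually_nhdsWithin_sign_eq_of_deriv_pos (hd h1.symm) h1.symm
      obtain ⟨u, hu, hu'⟩ := ((e.filter_mono nhdsWithin_le_nhds).and
        (show ∀ᶠ u in 𝓝[<] t₀, u ∈ Ioo 0 t₀ from hmem)).exists
      rw [sign_pos (hp u hu'), sign_neg (by linarith [hu'.2])] at hu
      exact absurd hu (by decide)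
  obtain ⟨k1, k2⟩ := H t₀ ht₀' hbefore
  have p1 := key f hfc (fun u hu => (hbefore u hu).1) k1
  have p2 := key g hgc (fun u hu => (hbefore u hu).2) k2
  exact absurd (lt_min p1 p2) (not_lt.2 hle)

/-- For `n ≥ 3`, `s > (n−1)/(n−2)`: along any C² solution of `(S_s)` on `[0,T)`,
`T ∈ (0,∞]`, with zero initial data, `x` is strictly increasing and `y` strictly
decreasing; in particular `x' > 0` and `y' < 0` on `(0,T)`. -/
theorem monotonicity_nonequilibrium
    (n : ℕ) (hn : 3 ≤ n) (s : ℝ) (hs : ((n : ℝ) - 1) / ((n : ℝ) - 2) < s)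
    (T : EReal) (hT : 0 < T) (x y : ℝ → ℝ)
    (hx : ContDiffOn ℝ 2 x {t : ℝ | 0 ≤ t ∧ (t : EReal) < T})
    (hy : ContDiffOn ℝ 2 y {t : ℝ | 0 ≤ t ∧ (t : EReal) < T})
    (hsys : SysS n s x y {t : ℝ | 0 ≤ t ∧ (t : EReal) < T})
    (hinit : ZeroInit x y) :
    StrictMonoOn x {t : ℝ | 0 ≤ t ∧ (t : EReal) < T} ∧
    StrictAntiOn y {t : ℝ | 0 ≤ t ∧ (t : EReal) < T} ∧
    ∀ t : ℝ, 0 < t → (t : EReal) < T → 0 < deriv x t ∧ deriv y t < 0 := by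
  have hn3 : (3:ℝ) ≤ n := by exact_mod_cast hn
  have hs1 : (n:ℝ) - 1 < s * (n - 2) := (div_lt_iff₀ (by linarith)).1 hs
  have hs0 : 1 < s := by nlinarith
  have hinv : (1 / s) * ((n:ℝ) - 1) < n - 2 := by
    rw [one_div_mul_eq_div, div_lt_iff₀ (by linarith)]; linarith
  have hinv0 : 0 < (1 / s) * ((n:ℝ) - 1) := by
    have : 0 < 1 / s := by positivity
    exact mul_pos this (by linarith)
  obtain ⟨x0, y0, dx0, dy0⟩ := hinit
  set I : Set ℝ := {t : ℝ | 0 ≤ t ∧ (t : EReal) < T} with hI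
  have hU : IsOpen {t : ℝ | 0 < t ∧ (t : EReal) < T} :=
    (isOpen_lt continuous_const continuous_id).inter
      (isOpen_lt continuous_coe_real_ereal continuous_const)
  have hUI : {t : ℝ | 0 < t ∧ (t : EReal) < T} ⊆ I := fun t ht => ⟨ht.1.le, ht.2⟩
  have hxc := (hx.mono hUI).continuousOn_deriv_of_isOpen hU (by norm_num)
  have hyc := (hy.mono hUI).continuousOn_deriv_of_isOpen hU (by norm_num)
  have hlt : ∀ {u b : ℝ}, u ≤ b → (b : EReal) < T → (u : EReal) < T := fun h1 h2 =>
    lt_of_le_of_lt (EReal.coe_le_coe_iff.2 h1) h2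
  have hdn : ∀ t, deriv (fun t => - deriv y t) t = - deriv (deriv y) t := fun t => deriv.fun_neg
  have main : ∀ t : ℝ, 0 < t → (t : EReal) < T → 0 < deriv x t ∧ deriv y t < 0 := by
    intro b hb hbT
    have hsubU : Ioc 0 b ⊆ {t : ℝ | 0 < t ∧ (t : EReal) < T} := fun u hu =>
      ⟨hu.1, hlt hu.2 hbT⟩
    obtain ⟨e1, e2⟩ := hsys 0 ⟨le_rfl, by exact_mod_cast hT⟩
    rw [x0, dx0, dy0] at e1
    rw [y0, dx0, dy0] at e2
    norm_num at e1 e2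
    have hinv' := hinv
    rw [one_div] at hinv'
    have := pair_pos (deriv x) (fun t => - deriv y t) b (hxc.mono hsubU) (hyc.mono hsubU).neg
      dx0 (by simp [dy0]) (by rw [e1]; linarith) (by rw [hdn, e2]; linarith) ?_ b ⟨hb, le_rfl⟩
    · exact ⟨this.1, by linarith [this.2]⟩
    intro t ht hpos
    have hsubI : Icc 0 t ⊆ I := fun u hu => ⟨hu.1, hlt (hu.2.trans ht.2) hbT⟩
    have hxt : 0 < x t := by
      have := strictMonoOn_of_deriv_pos (convex_Icc 0 t) (hx.continuousOn.mono hsubI)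
        (by rw [interior_Icc]; exact fun u hu => (hpos u hu).1)
        (left_mem_Icc.2 ht.1.le) (right_mem_Icc.2 ht.1.le) ht.1
      rwa [x0] at this
    have hyt : y t < 0 := by
      have := strictAntiOn_of_deriv_neg (convex_Icc 0 t) (hy.continuousOn.mono hsubI)
        (by rw [interior_Icc]; exact fun u hu => by linarith [(hpos u hu).2])
        (left_mem_Icc.2 ht.1.le) (right_mem_Icc.2 ht.1.le) ht.1
      rwa [y0] at this
    obtain ⟨e1, e2⟩ := hsys t (hsubI (right_mem_Icc.2 ht.1.le))
    constructor
    · intro h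
      have hexp : Real.exp (-2 * x t) < 1 := Real.exp_lt_one_iff.2 (by linarith)
      rw [e1, h]
      nlinarith
    · intro h
      have h' : deriv y t = 0 := by simpa using h
      have hexp : 1 < Real.exp (-2 * y t) := Real.one_lt_exp_iff.2 (by linarith)
      rw [hdn, e2, h']
      have hc : (n:ℝ) < (2 - 1 / s) * ((n:ℝ) - 1) := by linarith
      nlinarith
  have hconv : Convex ℝ I := by
    apply OrdConnected.convex
    exact ⟨fun a ha b hb u hu => ⟨ha.1.trans hu.1, hlt hu.2 hb.2⟩⟩
  have hint : ∀ t ∈ interior I, 0 < t ∧ (t : EReal) < T := by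
    intro t ht
    refine ⟨?_, (interior_subset ht).2⟩
    have : interior I ⊆ interior (Ici 0) := interior_mono fun u hu => hu.1
    rw [interior_Ici] at this
    exact this ht
  exact ⟨strictMonoOn_of_deriv_pos hconv hx.continuousOn
      fun t ht => (main t (hint t ht).1 (hint t ht).2).1,
    strictAntiOn_of_deriv_neg hconv hy.continuousOn
      fun t ht => (main t (hint t ht).1 (hint t ht).2).2, main⟩
end

section
/- Let t₁ ∈ ℝ and let C > 0 and K > 0 be real constants. Then there is no differentiable function v : [t₁, ∞) → ℝ satisfying the differential inequality v'(t) ≤ −C − K·(v(t))² for all t ≥ t₁; i.e., any differentiable function satisfying this Riccati-type inequality must cease to exist (tend to −∞) in finite time. -/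
open Real Set Filter

/-- Riccati comparison: for `C, K > 0` there is no differentiable function
`v : [t₁,∞) → ℝ` with `v' ≤ −C − K·v²` everywhere; such a function must blow up to
`−∞` in finite time. -/
theorem riccati_no_global_solution
    (t₁ C K : ℝ) (hC : 0 < C) (hK : 0 < K) :
    ¬ ∃ v : ℝ → ℝ,
        (∀ t ∈ Ici t₁, DifferentiableAt ℝ v t) ∧
        (∀ t ∈ Ici t₁, deriv v t ≤ -C - K * (v t) ^ 2) := by
  rintro ⟨v, hd, hv⟩
  obtain ⟨a, ha, haC⟩ : ∃ a : ℝ, 0 < a ∧ a ^ 2 * C = K := by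
    refine ⟨Real.sqrt (K / C), Real.sqrt_pos.mpr (div_pos hK hC), ?_⟩
    rw [Real.sq_sqrt (div_pos hK hC).le]
    field_simp
  have hder : ∀ t ∈ Ici t₁, HasDerivAt (fun t => Real.arctan (a * v t) + a * C * t)
      (1 / (1 + (a * v t) ^ 2) * (a * deriv v t) + a * C * 1) t := fun t ht =>
    (((hd t ht).hasDerivAt.const_mul a).arctan).add ((hasDerivAt_id t).const_mul (a * C))
  have hanti : AntitoneOn (fun t => Real.arctan (a * v t) + a * C * t) (Ici t₁) := by
    apply antitoneOn_of_deriv_nonpos (convex_Ici t₁)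
    · exact fun t ht => (hder t ht).continuousAt.continuousWithinAt
    · exact fun t ht =>
        (hder t (interior_subset ht)).differentiableAt.differentiableWithinAt
    · intro t ht
      have ht' := interior_subset ht
      rw [(hder t ht').deriv]
      have hpos : 0 < 1 + (a * v t) ^ 2 := by positivity
      have h1 : a * deriv v t ≤ -(a * C) * (1 + (a * v t) ^ 2) := by
        have h2 := mul_le_mul_of_nonneg_left (hv t ht') ha.le
        rw [← haC] at h2
        linarith
      have h3 : 1 / (1 + (a * v t) ^ 2) * (a * deriv v t) ≤ -(a * C) := by
        rw [one_div_mul_eq_div, div_le_iff₀ hpos]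
        exact h1
      linarith
  have hb : 0 < a * C := mul_pos ha hC
  have hle : t₁ ≤ t₁ + Real.pi / (a * C) := by
    have := div_pos Real.pi_pos hb
    linarith
  have h := hanti (mem_Ici.mpr le_rfl) (mem_Ici.mpr hle) hle
  have e : a * C * (t₁ + Real.pi / (a * C)) = a * C * t₁ + Real.pi := by
    field_simp
  simp only [e] at h
  have h1 := Real.arctan_lt_pi_div_two (a * v t₁)
  have h2 := Real.neg_pi_div_two_lt_arctan (a * v (t₁ + Real.pi / (a * C)))
  linarith
end

section
/- Let n ≥ 3 be an integer and let 1 < s < (n−1)/(n−2). Let T ∈ (0,∞] and let x, y : [0,T) → ℝ be twice continuously differentiable functions satisfying the system (S_s) with zero initial data. Then both x and y are strictly monotonically increasing on [0,T); in particular x'(t) > 0 and y'(t) > 0 for all t ∈ (0,T). -/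
open Real Set Filter

lemma aux_right {u : ℝ → ℝ} {a : ℝ} (hd : 0 < deriv u a) (h0 : u a = 0) :
    ∃ e > a, ∀ t, a < t → t < e → 0 < u t := by
  have h := eventually_nhdsWithin_sign_eq_of_deriv_pos hd h0
  obtain ⟨e, he, h⟩ := Metric.eventually_nhds_iff.1 h
  refine ⟨a + e, by linarith, fun t h1 h2 => ?_⟩
  have := h (y := t) (by rw [Real.dist_eq, abs_lt]; constructor <;> linarith)
  rw [sign_pos (sub_pos.2 h1)] at this
  exact sign_eq_one_iff.1 this

lemma aux_left {u : ℝ → ℝ} {a : ℝ} (hd : 0 < deriv u a) (h0 : u a = 0) (ha : 0 < a)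
    (hp : ∀ t, 0 < t → t < a → 0 < u t) : False := by
  have h := eventually_nhdsWithin_sign_eq_of_deriv_pos hd h0
  obtain ⟨e, he, h⟩ := Metric.eventually_nhds_iff.1 h
  have hm : 0 < min e a := lt_min he ha
  have m1 := min_le_left e a
  have m2 := min_le_right e a
  have := h (y := a - min e a / 2) (by rw [Real.dist_eq, abs_lt]; constructor <;> linarith)
  rw [sign_neg (by linarith : a - min e a / 2 - a < 0)] at this
  have h1 := sign_eq_neg_one_iff.1 this
  have h2 := hp (a - min e a / 2) (by linarith) (by linarith)
  linarith

lemma aux_diff {x : ℝ → ℝ} {T : EReal}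
    (hx : ContDiffOn ℝ 2 x {t : ℝ | 0 ≤ t ∧ (t : EReal) < T}) (t : ℝ) (h0 : 0 < t)
    (hT : (t : EReal) < T) : ContinuousAt (deriv x) t := by
  have hopen : IsOpen {t : ℝ | 0 < t ∧ (t : EReal) < T} :=
    (isOpen_lt continuous_const continuous_id).inter
      (isOpen_lt continuous_coe_real_ereal continuous_const)
  have h2 : ContDiffOn ℝ 2 x {t : ℝ | 0 < t ∧ (t : EReal) < T} :=
    hx.mono fun r hr => ⟨hr.1.le, hr.2⟩
  exact (h2.continuousOn_deriv_of_isOpen hopen (by norm_num)).continuousAt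
    (hopen.mem_nhds ⟨h0, hT⟩)

lemma aux_mono {x : ℝ → ℝ} {a : ℝ} (hc : ContinuousOn x (Icc 0 a)) (ha : 0 < a) (h0 : x 0 = 0)
    (hp : ∀ t, 0 < t → t < a → 0 < deriv x t) : 0 < x a := by
  have := strictMonoOn_of_deriv_pos (convex_Icc 0 a) hc (by
    intro t ht; rw [interior_Icc] at ht; exact hp t ht.1 ht.2)
  have := this (left_mem_Icc.2 ha.le) (right_mem_Icc.2 ha.le) ha
  linarith

lemma aux_rhs {c k z : ℝ} (hc : 0 < c) (hk : c < k) (hz : 0 ≤ z) :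
    0 < k - c * Real.exp (-2 * z) := by
  have : Real.exp (-2 * z) ≤ 1 := Real.exp_le_one_iff.2 (by linarith)
  nlinarith

/-- For `n ≥ 3`, `1 < s < (n−1)/(n−2)`: along any C² solution of `(S_s)` on `[0,T)`,
`T ∈ (0,∞]`, with zero initial data, both `x` and `y` are strictly increasing;
in particular `x' > 0` and `y' > 0` on `(0,T)`. -/
theorem monotonicity_equilibrium
    (n : ℕ) (hn : 3 ≤ n) (s : ℝ) (hs1 : 1 < s) (hs2 : s < ((n : ℝ) - 1) / ((n : ℝ) - 2))
    (T : EReal) (hT : 0 < T) (x y : ℝ → ℝ)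
    (hx : ContDiffOn ℝ 2 x {t : ℝ | 0 ≤ t ∧ (t : EReal) < T})
    (hy : ContDiffOn ℝ 2 y {t : ℝ | 0 ≤ t ∧ (t : EReal) < T})
    (hsys : SysS n s x y {t : ℝ | 0 ≤ t ∧ (t : EReal) < T})
    (hinit : ZeroInit x y) :
    StrictMonoOn x {t : ℝ | 0 ≤ t ∧ (t : EReal) < T} ∧
    StrictMonoOn y {t : ℝ | 0 ≤ t ∧ (t : EReal) < T} ∧
    ∀ t : ℝ, 0 < t → (t : EReal) < T → 0 < deriv x t ∧ 0 < deriv y t := by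
  obtain ⟨x0, y0, u0, v0⟩ := hinit
  have hn' : (3 : ℝ) ≤ n := by exact_mod_cast hn
  have hs0 : 0 < s := by linarith
  have hi1 : 1 / s < 1 := by rw [div_lt_one hs0]; exact hs1
  have hi0 : 0 < 1 / s := by positivity
  have hc1 : 0 < (1 / s) * ((n : ℝ) - 1) := mul_pos hi0 (by linarith)
  have hc2 : 0 < (2 - 1 / s) * ((n : ℝ) - 1) := mul_pos (by linarith) (by linarith)
  have hk1 : (1 / s) * ((n : ℝ) - 1) < n := by nlinarith
  have hk2 : (2 - 1 / s) * ((n : ℝ) - 1) < n := by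
    rw [lt_div_iff₀ (by linarith)] at hs2
    have : (n : ℝ) - 2 < (1 / s) * ((n : ℝ) - 1) := by
      rw [one_div, inv_mul_eq_div, lt_div_iff₀ hs0]; linarith
    linarith
  have dpx : ∀ t : ℝ, 0 ≤ t → (t : EReal) < T → 0 ≤ x t → deriv x t = 0 →
      0 < deriv (deriv x) t := by
    intro t h0 h1 h2 h3
    have := aux_rhs hc1 hk1 h2
    rw [(hsys t ⟨h0, h1⟩).1, h3]; linarith
  have dpy : ∀ t : ℝ, 0 ≤ t → (t : EReal) < T → 0 ≤ y t → deriv y t = 0 →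
      0 < deriv (deriv y) t := by
    intro t h0 h1 h2 h3
    have := aux_rhs hc2 hk2 h2
    rw [(hsys t ⟨h0, h1⟩).2, h3]; linarith
  have hT0 : ((0 : ℝ) : EReal) < T := by simpa using hT
  obtain ⟨e1, he1, hu⟩ := aux_right (dpx 0 le_rfl hT0 x0.ge u0) u0
  obtain ⟨e2, he2, hv⟩ := aux_right (dpy 0 le_rfl hT0 y0.ge v0) v0
  have main : ∀ t : ℝ, 0 < t → (t : EReal) < T → 0 < deriv x t ∧ 0 < deriv y t := by
    intro t1 ht1 hT1
    by_contra hcon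
    have hbad : deriv x t1 ≤ 0 ∨ deriv y t1 ≤ 0 := by
      by_contra h; push Not at h; exact hcon h
    set e := min e1 e2 with he
    have hepos : 0 < e := lt_min he1 he2
    have hsmall : ∀ t, 0 < t → t < e → 0 < deriv x t ∧ 0 < deriv y t := fun t a b =>
      ⟨hu t a (b.trans_le (min_le_left _ _)), hv t a (b.trans_le (min_le_right _ _))⟩
    have het : e ≤ t1 := by
      by_contra h; exact hcon (hsmall t1 ht1 (not_le.1 h))
    have hlt : ∀ t : ℝ, t ≤ t1 → (t : EReal) < T := fun t h =>
      lt_of_le_of_lt (EReal.coe_le_coe_iff.2 h) hT1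
    have cu : ContinuousOn (deriv x) (Icc e t1) := fun t ht =>
      (aux_diff hx t (hepos.trans_le ht.1) (hlt t ht.2)).continuousWithinAt
    have cv : ContinuousOn (deriv y) (Icc e t1) := fun t ht =>
      (aux_diff hy t (hepos.trans_le ht.1) (hlt t ht.2)).continuousWithinAt
    have hcomp : IsCompact (Icc e t1 ∩ (fun t => min (deriv x t) (deriv y t)) ⁻¹' Iic 0) :=
      isCompact_Icc.of_isClosed_subset
        ((ContinuousOn.inf cu cv).preimage_isClosed_of_isClosed isClosed_Icc isClosed_Iic)
        inter_subset_left
    obtain ⟨t0, ⟨ht0, hm0⟩, hleast⟩ := hcomp.exists_isLeast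
      ⟨t1, ⟨het, le_rfl⟩, by simpa using hbad⟩
    have hp0 : 0 < t0 := hepos.trans_le ht0.1
    have hpos : ∀ t, 0 < t → t < t0 → 0 < deriv x t ∧ 0 < deriv y t := by
      intro t a b
      by_contra hc
      have hb : deriv x t ≤ 0 ∨ deriv y t ≤ 0 := by
        by_contra h; push Not at h; exact hc h
      have : e ≤ t := by
        by_contra h; exact hc (hsmall t a (not_le.1 h))
      have := hleast ⟨⟨this, b.le.trans ht0.2⟩, by simpa using hb⟩
      linarith
    have hsub : Icc 0 t0 ⊆ {t : ℝ | 0 ≤ t ∧ (t : EReal) < T} := fun t ht =>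
      ⟨ht.1, hlt t (ht.2.trans ht0.2)⟩
    have hX := aux_mono (hx.continuousOn.mono hsub) hp0 x0 fun t a b => (hpos t a b).1
    have hY := aux_mono (hy.continuousOn.mono hsub) hp0 y0 fun t a b => (hpos t a b).2
    have hnn : ∀ f : ℝ → ℝ, ContinuousAt f t0 → (∀ t, 0 < t → t < t0 → 0 < f t) → 0 ≤ f t0 := by
      intro f hf hfp
      refine ge_of_tendsto (hf.tendsto.mono_left (nhdsWithin_le_nhds (s := Iio t0))) ?_
      filter_upwards [Ioo_mem_nhdsLT hp0] with t ht using (hfp t ht.1 ht.2).le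
    have hT0' := hlt t0 ht0.2
    have nu := hnn _ (aux_diff hx t0 hp0 hT0') fun t a b => (hpos t a b).1
    have nv := hnn _ (aux_diff hy t0 hp0 hT0') fun t a b => (hpos t a b).2
    have hm1 : deriv x t0 ≤ 0 ∨ deriv y t0 ≤ 0 := by simpa using hm0
    rcases hm1 with h | h
    · have h := le_antisymm h nu
      exact aux_left (dpx t0 hp0.le hT0' hX.le h) h hp0 fun t a b => (hpos t a b).1
    · have h := le_antisymm h nv
      exact aux_left (dpy t0 hp0.le hT0' hY.le h) h hp0 fun t a b => (hpos t a b).2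
  have hconv : Convex ℝ {t : ℝ | 0 ≤ t ∧ (t : EReal) < T} := by
    apply OrdConnected.convex
    refine ⟨fun a ha b hb c hc => ⟨ha.1.trans hc.1, ?_⟩⟩
    exact lt_of_le_of_lt (EReal.coe_le_coe_iff.2 hc.2) hb.2
  have hint : ∀ t ∈ interior {t : ℝ | 0 ≤ t ∧ (t : EReal) < T}, 0 < t ∧ (t : EReal) < T := by
    intro t ht
    refine ⟨?_, (interior_subset ht).2⟩
    have : t ∈ interior (Ici (0 : ℝ)) := interior_mono (fun r hr => hr.1) ht
    simpa using this
  exact ⟨strictMonoOn_of_deriv_pos hconv hx.continuousOn fun t ht =>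
      (main t (hint t ht).1 (hint t ht).2).1,
    strictMonoOn_of_deriv_pos hconv hy.continuousOn fun t ht =>
      (main t (hint t ht).1 (hint t ht).2).2, main⟩
end

section
/- Let n ≥ 3 be an integer and let 1 < s < (n−1)/(n−2). Let T ∈ (0,∞] and let x, y : [0,T) → ℝ be twice continuously differentiable functions satisfying the system (S_s) with zero initial data. Then: (i) 0 < x'(t) + y'(t) ≤ 2 for all t ∈ (0,T); and (ii) for every t₁ ∈ (0,T) and every t ∈ [t₁, T), one has x'(t) + y'(t) ≥ min(x'(t₁) + y'(t₁), 1). In particular, for a global solution the sum x' + y' is bounded and bounded away from zero for large times, so x + y grows at least linearly. -/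
open Real Set Filter

lemma barrier_aux (f f' : ℝ → ℝ) (c t0 t1 : ℝ) (h01 : t0 ≤ t1)
    (hc : ContinuousOn f (Icc t0 t1))
    (hd : ∀ t, t0 < t → t ≤ t1 → HasDerivAt f (f' t) t)
    (h0 : c ≤ f t0) (hb : ∀ t, t0 < t → t ≤ t1 → f t < c → 0 ≤ f' t) : c ≤ f t1 := by
  by_contra hlt
  push Not at hlt
  have hS : IsCompact (Icc t0 t1 ∩ f ⁻¹' Ici c) :=
    isCompact_Icc.of_isClosed_subset (hc.preimage_isClosed_of_isClosed isClosed_Icc isClosed_Ici)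
      inter_subset_left
  obtain ⟨u, ⟨⟨hu0, hu1⟩, hfu⟩, hmax⟩ := hS.exists_isGreatest ⟨t0, ⟨le_refl _, h01⟩, h0⟩
  have hfu' : c ≤ f u := hfu
  have hne : u < t1 := lt_of_le_of_ne hu1 (by rintro rfl; linarith)
  obtain ⟨w, hw, hw'⟩ := exists_hasDerivAt_eq_slope f f' hne
    (hc.mono (Icc_subset_Icc_left hu0)) (fun t ht => hd t (by linarith [ht.1]) ht.2.le)
  have hwc : f w < c := by
    by_contra h
    push Not at h
    have := hmax ⟨⟨by linarith [hw.1], hw.2.le⟩, h⟩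
    linarith [hw.1]
  have h1 := hb w (by linarith [hw.1]) hw.2.le hwc
  rw [hw'] at h1
  have : (f t1 - f u) / (t1 - u) < 0 := div_neg_of_neg_of_pos (by linarith) (by linarith)
  linarith

lemma pos_aux (z a a' : ℝ → ℝ) (τ a0 : ℝ) (hz0 : z 0 = 0) (ha0 : a 0 = 0)
    (hzc : ContinuousOn z (Icc 0 τ)) (hac : ContinuousOn a (Icc 0 τ))
    (hz : ∀ t, 0 < t → t ≤ τ → HasDerivAt z (a t) t)
    (ha : ∀ t, 0 < t → t ≤ τ → HasDerivAt a (a' t) t)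
    (h0 : HasDerivAt a a0 0) (h0p : 0 < a0)
    (hp : ∀ t, 0 < t → t ≤ τ → 0 ≤ z t → a t = 0 → 0 < a' t) :
    ∀ t, 0 < t → t ≤ τ → 0 < a t := by
  intro t1 ht1 ht1τ
  by_contra hneg
  push Not at hneg
  have hev : ∀ᶠ t in nhdsWithin (0:ℝ) (Ioi 0), 0 < a t := by
    have h1 := (hasDerivAt_iff_tendsto_slope.1 h0).eventually (lt_mem_nhds h0p)
    have h2 := h1.filter_mono (nhdsWithin_mono (0:ℝ) (fun t (ht : 0 < t) => ht.ne'))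
    filter_upwards [h2, self_mem_nhdsWithin] with t ht ht'
    rw [slope_def_field, ha0] at ht
    have ht'' : 0 < t := ht'
    have := (div_pos_iff_of_pos_right (by linarith : (0:ℝ) < t - 0)).1 ht
    linarith
  obtain ⟨e, he, hea⟩ := (mem_nhdsGT_iff_exists_Ioo_subset).1 hev
  have he0 : (0:ℝ) < e := he
  have hea' : ∀ t, 0 < t → t < e → 0 < a t := fun t h1 h2 => hea ⟨h1, h2⟩
  have het : e ≤ t1 := by
    by_contra h
    push Not at h
    linarith [hea' t1 ht1 h]
  have hS : IsCompact (Icc e t1 ∩ a ⁻¹' Iic 0) :=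
    isCompact_Icc.of_isClosed_subset
      ((hac.mono (Icc_subset_Icc he0.le ht1τ)).preimage_isClosed_of_isClosed isClosed_Icc isClosed_Iic)
      inter_subset_left
  obtain ⟨u, ⟨⟨hu0, hu1⟩, hfu⟩, hmin⟩ := hS.exists_isLeast ⟨t1, ⟨het, le_refl _⟩, hneg⟩
  have hfu' : a u ≤ 0 := hfu
  have hbef : ∀ t, 0 < t → t < u → 0 < a t := by
    intro t h1 h2
    by_contra h
    push Not at h
    rcases lt_or_ge t e with h3 | h3
    · linarith [hea' t h1 h3]
    · have := hmin ⟨⟨h3, by linarith⟩, h⟩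
      linarith
  have hupos : 0 < u := by linarith
  have huτ : u ≤ τ := by linarith
  have hzu : 0 ≤ z u := by
    obtain ⟨w, hw, hw'⟩ := exists_hasDerivAt_eq_slope z a hupos
      (hzc.mono (Icc_subset_Icc_right huτ)) (fun t ht => hz t ht.1 (by linarith [ht.2]))
    have h1 := hbef w hw.1 hw.2
    rw [hw', hz0] at h1
    have := (div_pos_iff_of_pos_right (by linarith : (0:ℝ) < u - 0)).1 h1
    linarith
  have hdu := ha u hupos huτ
  have hev2 : ∀ᶠ t in nhdsWithin u (Iio u), 0 < a t := by
    filter_upwards [Ioo_mem_nhdsLT hupos] with t ht using hbef t ht.1 ht.2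
  have hau : a u = 0 := by
    apply le_antisymm hfu'
    have h1 : Tendsto a (nhdsWithin u (Iio u)) (nhds (a u)) :=
      hdu.continuousAt.tendsto.mono_left nhdsWithin_le_nhds
    exact ge_of_tendsto h1 (hev2.mono fun t ht => ht.le)
  have hpu := hp u hupos huτ hzu hau
  have h1 := (hasDerivAt_iff_tendsto_slope.1 hdu).eventually (lt_mem_nhds hpu)
  have h2 : ∀ᶠ t in nhdsWithin u (Iio u), 0 < slope a u t :=
    h1.filter_mono (nhdsWithin_mono u (fun t (ht : t < u) => ht.ne))
  obtain ⟨t, ht1', ht2, ht3⟩ := (h2.and (hev2.and self_mem_nhdsWithin)).exists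
  have ht3' : t < u := ht3
  rw [slope_def_field, hau] at ht1'
  have : (a t - 0) / (t - u) < 0 := div_neg_of_pos_of_neg (by linarith) (by linarith)
  linarith

lemma cons_aux (N k l : ℝ) (hkl : k + l = 2) (x y a b a' b' : ℝ → ℝ) (τ : ℝ)
    (hx0 : x 0 = 0) (hy0 : y 0 = 0) (ha0 : a 0 = 0) (hb0 : b 0 = 0)
    (hxc : ContinuousOn x (Icc 0 τ)) (hyc : ContinuousOn y (Icc 0 τ))
    (hac : ContinuousOn a (Icc 0 τ)) (hbc : ContinuousOn b (Icc 0 τ))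
    (hx : ∀ t, 0 < t → t ≤ τ → HasDerivAt x (a t) t)
    (hy : ∀ t, 0 < t → t ≤ τ → HasDerivAt y (b t) t)
    (ha : ∀ t, 0 < t → t ≤ τ → HasDerivAt a (a' t) t)
    (hb : ∀ t, 0 < t → t ≤ τ → HasDerivAt b (b' t) t)
    (ea : ∀ t, 0 < t → t ≤ τ →
      a' t = N - k * (N - 1) * exp (-2 * x t) - N / 2 * (a t ^ 2 + a t * b t))
    (eb : ∀ t, 0 < t → t ≤ τ →
      b' t = N - l * (N - 1) * exp (-2 * y t) - N / 2 * (b t ^ 2 + a t * b t)) :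
    ∀ t, 0 < t → t ≤ τ → a' t + b' t = 2 - a t ^ 2 - b t ^ 2 := by
  intro t ht htτ
  have hsub : Icc 0 t ⊆ Icc 0 τ := Icc_subset_Icc_right htτ
  have hxc := hxc.mono hsub
  have hyc := hyc.mono hsub
  have hac := hac.mono hsub
  have hbc := hbc.mono hsub
  obtain ⟨w, hw, hw'⟩ := exists_hasDerivAt_eq_slope
    (fun u => (2 * N - 2 - (N - 1) * (k * exp (-2 * x u) + l * exp (-2 * y u))
      - N / 2 * (a u + b u) ^ 2 + a u ^ 2 + b u ^ 2) * exp (N * (x u + y u)))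
    (fun _ => 0) ht (by fun_prop) (by
      intro u hu
      have h1 := hx u hu.1 (by linarith [hu.2])
      have h2 := hy u hu.1 (by linarith [hu.2])
      have h3 := ha u hu.1 (by linarith [hu.2])
      have h4 := hb u hu.1 (by linarith [hu.2])
      have e3 := ea u hu.1 (by linarith [hu.2])
      have e4 := eb u hu.1 (by linarith [hu.2])
      have hX := (h1.const_mul (-2)).exp
      have hY := (h2.const_mul (-2)).exp
      have hE := ((h1.add h2).const_mul N).exp
      have hF := (((((((hX.const_mul k).add (hY.const_mul l)).const_mul (N - 1)).const_sub
        (2 * N - 2)).sub (((h3.add h4).pow 2).const_mul (N / 2))).add (h3.pow 2)).add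
        (h4.pow 2)).mul hE
      refine hF.congr_deriv ?_
      simp only [Pi.add_apply, Pi.sub_apply, Pi.pow_apply]
      rw [e3, e4]
      push_cast
      ring)
  have hne : t - 0 ≠ 0 := by linarith
  rw [eq_comm, div_eq_zero_iff] at hw'
  have h5 := hw'.resolve_right hne
  simp only [hx0, hy0, ha0, hb0, mul_zero, add_zero, Real.exp_zero] at h5
  have h6 : (2 * N - 2 - (N - 1) * (k * exp (-2 * x t) + l * exp (-2 * y t))
      - N / 2 * (a t + b t) ^ 2 + a t ^ 2 + b t ^ 2) * exp (N * (x t + y t)) = 0 := by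
    linear_combination h5 - (N - 1) * hkl
  have h7 := (mul_eq_zero.1 h6).resolve_right (exp_ne_zero _)
  rw [ea t ht htτ, eb t ht htτ]
  linear_combination h7

lemma reg_aux (T : EReal) (x : ℝ → ℝ)
    (hx : ContDiffOn ℝ 2 x {t : ℝ | 0 ≤ t ∧ (t : EReal) < T}) :
    ∀ t : ℝ, 0 < t → (t : EReal) < T →
      HasDerivAt x (deriv x t) t ∧ HasDerivAt (deriv x) (deriv (deriv x) t) t := by
  intro t ht htT
  have hopen : IsOpen {t : ℝ | (t : EReal) < T} :=
    isOpen_lt continuous_coe_real_ereal continuous_const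
  have hnh : {t : ℝ | 0 ≤ t ∧ (t : EReal) < T} ∈ nhds t := by
    filter_upwards [Ioi_mem_nhds ht, hopen.mem_nhds htT] with u h1 h2
    exact ⟨le_of_lt h1, h2⟩
  have hc : ContDiffAt ℝ 2 x t := hx.contDiffAt hnh
  refine ⟨(hc.differentiableAt (by norm_num)).hasDerivAt, ?_⟩
  have h1 : ContDiffAt ℝ 1 (deriv x) t := by
    have h2 : ContDiffAt ℝ 1 (fderiv ℝ x) t := hc.fderiv_right (by norm_num)
    exact h2.clm_apply contDiffAt_const
  exact (h1.differentiableAt (by norm_num)).hasDerivAt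

/-- For `n ≥ 3`, `1 < s < (n−1)/(n−2)`: along any C² solution of `(S_s)` on `[0,T)`,
`T ∈ (0,∞]`, with zero initial data, (i) `0 < x' + y' ≤ 2` on `(0,T)` and
(ii) for `0 < t₁ ≤ t < T`, `x'(t) + y'(t) ≥ min(x'(t₁) + y'(t₁), 1)`. -/
theorem sum_of_derivatives_bounds
    (n : ℕ) (hn : 3 ≤ n) (s : ℝ) (hs1 : 1 < s) (hs2 : s < ((n : ℝ) - 1) / ((n : ℝ) - 2))
    (T : EReal) (hT : 0 < T) (x y : ℝ → ℝ)
    (hx : ContDiffOn ℝ 2 x {t : ℝ | 0 ≤ t ∧ (t : EReal) < T})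
    (hy : ContDiffOn ℝ 2 y {t : ℝ | 0 ≤ t ∧ (t : EReal) < T})
    (hsys : SysS n s x y {t : ℝ | 0 ≤ t ∧ (t : EReal) < T})
    (hinit : ZeroInit x y) :
    (∀ t : ℝ, 0 < t → (t : EReal) < T →
      0 < deriv x t + deriv y t ∧ deriv x t + deriv y t ≤ 2) ∧
    (∀ t₁ : ℝ, 0 < t₁ → (t₁ : EReal) < T →
      ∀ t : ℝ, t₁ ≤ t → (t : EReal) < T →
        min (deriv x t₁ + deriv y t₁) 1 ≤ deriv x t + deriv y t) := by
  have hn3 : (3:ℝ) ≤ n := by exact_mod_cast hn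
  have hs0 : 0 < s := by linarith
  have hk0 : 0 < 1 / s := by positivity
  have hk1 : 1 / s < 1 := by rw [div_lt_one hs0]; exact hs1
  have hk2 : (n:ℝ) - 2 < 1 / s * (n - 1) := by
    rw [lt_div_iff₀ (by linarith)] at hs2
    rw [one_div, inv_mul_eq_div, lt_div_iff₀ hs0]
    linarith
  obtain ⟨hx0, hy0, ha0, hb0⟩ := hinit
  set k := 1 / s with hk
  have hmem0 : (0:ℝ) ∈ {t : ℝ | 0 ≤ t ∧ (t : EReal) < T} := ⟨le_refl _, by simpa using hT⟩
  obtain ⟨e0x, e0y⟩ := hsys 0 hmem0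
  rw [hx0, ha0, hb0] at e0x
  rw [hy0, ha0, hb0] at e0y
  simp only [mul_zero, Real.exp_zero] at e0x e0y
  have px : 0 < deriv (deriv x) 0 := by rw [e0x]; nlinarith
  have py : 0 < deriv (deriv y) 0 := by rw [e0y]; nlinarith
  have dx := (differentiableAt_of_deriv_ne_zero px.ne').hasDerivAt
  have dy := (differentiableAt_of_deriv_ne_zero py.ne').hasDerivAt
  have rx := reg_aux T x hx
  have ry := reg_aux T y hy
  have hlt : ∀ {t τ : ℝ}, t ≤ τ → (τ : EReal) < T → (t : EReal) < T :=
    fun h h' => lt_of_le_of_lt (EReal.coe_le_coe_iff.2 h) h'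
  have hsub : ∀ τ : ℝ, (τ : EReal) < T → Icc 0 τ ⊆ {t : ℝ | 0 ≤ t ∧ (t : EReal) < T} :=
    fun τ h t ht => ⟨ht.1, hlt ht.2 h⟩
  have cx : ∀ τ : ℝ, (τ : EReal) < T → ContinuousOn (deriv x) (Icc 0 τ) := by
    intro τ h t ht
    rcases ht.1.eq_or_lt with h0 | h0
    · rw [← h0]; exact dx.continuousAt.continuousWithinAt
    · exact (rx t h0 (hlt ht.2 h)).2.continuousAt.continuousWithinAt
  have cy : ∀ τ : ℝ, (τ : EReal) < T → ContinuousOn (deriv y) (Icc 0 τ) := by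
    intro τ h t ht
    rcases ht.1.eq_or_lt with h0 | h0
    · rw [← h0]; exact dy.continuousAt.continuousWithinAt
    · exact (ry t h0 (hlt ht.2 h)).2.continuousAt.continuousWithinAt
  have posx : ∀ τ : ℝ, 0 < τ → (τ : EReal) < T → 0 < deriv x τ := by
    intro τ h0 h
    refine pos_aux x (deriv x) (deriv (deriv x)) τ _ hx0 ha0 (hx.continuousOn.mono (hsub τ h))
      (cx τ h) (fun t h1 h2 => (rx t h1 (hlt h2 h)).1) (fun t h1 h2 => (rx t h1 (hlt h2 h)).2)
      dx px ?_ τ h0 le_rfl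
    intro t h1 h2 h3 h4
    rw [(hsys t ⟨h1.le, hlt h2 h⟩).1, h4]
    have h5 : exp (-2 * x t) ≤ 1 := exp_le_one_iff.2 (by linarith)
    have h6 : 0 ≤ k * ((n:ℝ) - 1) := mul_nonneg hk0.le (by linarith)
    nlinarith
  have posy : ∀ τ : ℝ, 0 < τ → (τ : EReal) < T → 0 < deriv y τ := by
    intro τ h0 h
    refine pos_aux y (deriv y) (deriv (deriv y)) τ _ hy0 hb0 (hy.continuousOn.mono (hsub τ h))
      (cy τ h) (fun t h1 h2 => (ry t h1 (hlt h2 h)).1) (fun t h1 h2 => (ry t h1 (hlt h2 h)).2)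
      dy py ?_ τ h0 le_rfl
    intro t h1 h2 h3 h4
    rw [(hsys t ⟨h1.le, hlt h2 h⟩).2, h4]
    have h5 : exp (-2 * y t) ≤ 1 := exp_le_one_iff.2 (by linarith)
    have h6 : 0 ≤ (2 - k) * ((n:ℝ) - 1) := mul_nonneg (by linarith) (by linarith)
    nlinarith
  have cons : ∀ τ : ℝ, 0 < τ → (τ : EReal) < T →
      deriv (deriv x) τ + deriv (deriv y) τ = 2 - deriv x τ ^ 2 - deriv y τ ^ 2 := by
    intro τ h0 h
    exact cons_aux n k (2 - k) (by ring) x y (deriv x) (deriv y) _ _ τ hx0 hy0 ha0 hb0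
      (hx.continuousOn.mono (hsub τ h)) (hy.continuousOn.mono (hsub τ h)) (cx τ h) (cy τ h)
      (fun t h1 h2 => (rx t h1 (hlt h2 h)).1) (fun t h1 h2 => (ry t h1 (hlt h2 h)).1)
      (fun t h1 h2 => (rx t h1 (hlt h2 h)).2) (fun t h1 h2 => (ry t h1 (hlt h2 h)).2)
      (fun t h1 h2 => (hsys t ⟨h1.le, hlt h2 h⟩).1) (fun t h1 h2 => (hsys t ⟨h1.le, hlt h2 h⟩).2)
      τ h0 le_rfl
  refine ⟨fun t h0 h => ⟨add_pos (posx t h0 h) (posy t h0 h), ?_⟩, ?_⟩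
  · have := barrier_aux (fun t => -(deriv x t + deriv y t))
      (fun t => -(deriv (deriv x) t + deriv (deriv y) t)) (-2) 0 t h0.le
      ((cx t h).add (cy t h)).neg
      (fun u h1 h2 => ((rx u h1 (hlt h2 h)).2.add (ry u h1 (hlt h2 h)).2).neg)
      (by simp only [ha0, hb0]; norm_num)
      (by
        intro u h1 h2 h3
        rw [cons u h1 (hlt h2 h)]
        nlinarith [sq_nonneg (deriv x u - deriv y u)])
    linarith
  · intro t1 ht1 _ t h12 h
    refine barrier_aux (fun t => deriv x t + deriv y t)
      (fun t => deriv (deriv x) t + deriv (deriv y) t) _ t1 t h12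
      (((cx t h).add (cy t h)).mono (Icc_subset_Icc_left ht1.le))
      (fun u h1 h2 => (rx u (by linarith) (hlt h2 h)).2.add (ry u (by linarith) (hlt h2 h)).2)
      (min_le_left _ _) ?_
    intro u h1 h2 h3
    have h4 : deriv x u + deriv y u < 1 := lt_of_lt_of_le h3 (min_le_right _ _)
    have p1 := posx u (by linarith) (hlt h2 h)
    have p2 := posy u (by linarith) (hlt h2 h)
    rw [cons u (by linarith) (hlt h2 h)]
    nlinarith
end

section
/- Let n ≥ 3 be an integer. Then the initial value problem x'' = n − (n−2)e^{−2x} − (n/2)(x')², x(0) = 0, x'(0) = 0, has a twice continuously differentiable solution x : [0,∞) → ℝ defined for all t ≥ 0. Moreover, x is strictly monotonically increasing, x''(t) < n for all t ≥ 0, and x grows at most quadratically: x(t) ≤ (n/2)t² for all t ≥ 0. -/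
open Real Set Filter

/-- The boundary case `s = (n−1)/(n−2)` of the system `(S_s)`: the scalar initial value
problem `x'' = n − (n−2)e^{−2x} − (n/2)(x')²`, `x(0) = x'(0) = 0`, has a global C²
solution on `[0,∞)` which is strictly increasing, satisfies `x'' < n`, and grows at
most quadratically: `x(t) ≤ (n/2)t²`. -/
theorem boundary_case_scalar_ode (n : ℕ) (hn : 3 ≤ n) :
    ∃ x : ℝ → ℝ,
      ContDiffOn ℝ 2 x (Ici (0 : ℝ)) ∧
      (∀ t ∈ Ici (0 : ℝ),
        deriv (deriv x) t =
          (n : ℝ) - ((n : ℝ) - 2) * Real.exp (-2 * x t)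
            - ((n : ℝ) / 2) * (deriv x t) ^ 2) ∧
      x 0 = 0 ∧ deriv x 0 = 0 ∧
      StrictMonoOn x (Ici (0 : ℝ)) ∧
      (∀ t ∈ Ici (0 : ℝ), deriv (deriv x) t < (n : ℝ)) ∧
      (∀ t ∈ Ici (0 : ℝ), x t ≤ ((n : ℝ) / 2) * t ^ 2) := by
  have hn' : (3 : ℝ) ≤ n := by exact_mod_cast hn
  have h2 : √2 * √2 = (2 : ℝ) := Real.mul_self_sqrt (by norm_num)
  have hs : (0 : ℝ) < √2 := by positivity
  have hc : ∀ t : ℝ, 0 < Real.cosh (√2 * t) := fun t => Real.cosh_pos _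
  have hlin : ∀ t : ℝ, HasDerivAt (fun t : ℝ => √2 * t) √2 t := fun t => by
    simpa using (hasDerivAt_id t).const_mul √2
  have hd1 : ∀ t : ℝ, HasDerivAt (fun t => Real.log (Real.cosh (√2 * t)))
      (Real.sinh (√2 * t) * √2 / Real.cosh (√2 * t)) t := fun t =>
    ((hlin t).cosh).log (hc t).ne'
  have e1 : deriv (fun t => Real.log (Real.cosh (√2 * t))) =
      fun t => Real.sinh (√2 * t) * √2 / Real.cosh (√2 * t) :=
    funext fun t => (hd1 t).deriv
  have e2 : ∀ t : ℝ, deriv (fun t => Real.sinh (√2 * t) * √2 / Real.cosh (√2 * t)) t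
      = 2 / Real.cosh (√2 * t) ^ 2 := fun t => by
    have h := ((((hlin t).sinh).mul_const √2).div ((hlin t).cosh) (hc t).ne')
    refine h.deriv.trans ?_
    congr 1
    linear_combination (Real.cosh (√2 * t) ^ 2 - Real.sinh (√2 * t) ^ 2) * h2
      + 2 * Real.cosh_sq_sub_sinh_sq (√2 * t)
  refine ⟨fun t => Real.log (Real.cosh (√2 * t)), ?_, ?_, ?_, ?_, ?_, ?_, ?_⟩
  · apply ContDiff.contDiffOn
    exact ContDiff.log (Real.contDiff_cosh.comp (contDiff_const.mul contDiff_id))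
      (fun t => (hc t).ne')
  · intro t _
    rw [e1, e2]
    have hexp : Real.exp (-2 * Real.log (Real.cosh (√2 * t))) =
        1 / Real.cosh (√2 * t) ^ 2 := by
      rw [show -2 * Real.log (Real.cosh (√2 * t)) =
        -(Real.log (Real.cosh (√2 * t)) + Real.log (Real.cosh (√2 * t))) by ring,
        Real.exp_neg, Real.exp_add, Real.exp_log (hc t), one_div, sq]
    simp only [hexp]
    have := (hc t).ne'
    have h3 := Real.cosh_sq_sub_sinh_sq (√2 * t)
    field_simp
    rw [Real.sq_sqrt (by norm_num)]
    linear_combination (-2 * (n : ℝ)) * h3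
  · simp
  · rw [e1]; simp
  · intro a ha b hb hab
    have ha' : (0 : ℝ) ≤ a := ha
    have hb' : (0 : ℝ) ≤ b := hb
    refine Real.log_lt_log (hc a) (Real.cosh_strictMonoOn ?_ ?_ ?_)
    · exact mul_nonneg hs.le ha'
    · exact mul_nonneg hs.le hb'
    · exact mul_lt_mul_of_pos_left hab hs
  · intro t _
    rw [e1, e2]
    have h1 := Real.one_le_cosh (√2 * t)
    have : 2 / Real.cosh (√2 * t) ^ 2 ≤ 2 := div_le_self (by norm_num) (by nlinarith)
    linarith
  · intro t _
    have h1 : Real.log (Real.cosh (√2 * t)) ≤ (√2 * t) ^ 2 / 2 := by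
      rw [Real.log_le_iff_le_exp (hc t)]
      exact Real.cosh_le_exp_half_sq _
    have h4 : (√2 * t) ^ 2 / 2 = t ^ 2 := by linear_combination (t ^ 2 / 2) * h2
    have := sq_nonneg t
    show Real.log (Real.cosh (√2 * t)) ≤ _
    nlinarith
end
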